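/- arXiv:2006.02015 — 2 statements merged into one kernel-verified Lean document; each statement's English description precedes it below -/
import Mathlib

section
/- Let 𝒢 be a hereditary class of graphs. If every graph G in 𝒢 with Δ(G) = 9 and ω(G) ≤ 8 satisfies χ(G) ≤ 8, then every graph G in 𝒢 with Δ(G) ≥ 9 and ω(G) ≤ Δ(G) - 1 satisfies χ(G) ≤ Δ(G) - 1. -/
open SimpleGraph

/-- Maximum degree of a finite graph. -/
noncomputable def maxDeg {V : Type*} [Fintype V] (G : SimpleGraph V) : ℕ :=
  Finset.univ.sup fun v => (G.neighborSet v).ncard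

/-- Choosing one element from each of finitely many pairs so as to avoid a matching. -/
theorem exists_choice_avoiding_matching {ι : Type*} (s : Finset ι)
    (R : ι × Bool → ι × Bool → Prop) (hsymm : ∀ x y, R x y → R y x)
    (hfun : ∀ x y z, R x y → R x z → y = z) :
    ∃ c : ι → Bool, ∀ i ∈ s, ∀ j ∈ s, i ≠ j → ¬ R (i, c i) (j, c j) := by
  classical
  induction s using Finset.induction_on generalizing R with
  | empty => exact ⟨fun _ => true, by simp⟩
  | insert i s his ih =>
    obtain ⟨c, hc⟩ := ih
      (fun x y => x.1 ≠ i ∧ y.1 ≠ i ∧ (R x y ∨ ∃ a, R (i, a) x ∧ R (i, !a) y))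
      (by
        rintro x y ⟨hx, hy, h | ⟨a, h1, h2⟩⟩
        · exact ⟨hy, hx, Or.inl (hsymm _ _ h)⟩
        · exact ⟨hy, hx, Or.inr ⟨!a, h2, by simpa using h1⟩⟩)
      (by
        rintro x y z ⟨hx, hy, h⟩ ⟨-, hz, h'⟩
        rcases h with h | ⟨a, h1, h2⟩ <;> rcases h' with h' | ⟨a', h1', h2'⟩
        · exact hfun _ _ _ h h'
        · exact absurd (by rw [hfun _ _ _ h (hsymm _ _ h1')]) hy
        · exact absurd (by rw [hfun _ _ _ h' (hsymm _ _ h1)]) hz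
        · have : a = a' := by
            simpa using hfun _ _ _ (hsymm _ _ h1) (hsymm _ _ h1')
          subst this
          exact hfun _ _ _ h2 h2')
    have key : ∃ a, ∀ j ∈ s, ¬ R (i, a) (j, c j) := by
      by_contra! hcon
      obtain ⟨j, hj, hRj⟩ := hcon true
      obtain ⟨l, hl, hRl⟩ := hcon false
      by_cases hjl : j = l
      · subst hjl
        simpa using hfun _ _ _ (hsymm _ _ hRj) (hsymm _ _ hRl)
      · exact hc j hj l hl hjl
          ⟨fun h => his (h ▸ hj), fun h => his (h ▸ hl), Or.inr ⟨true, hRj, hRl⟩⟩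
    obtain ⟨a, ha⟩ := key
    refine ⟨Function.update c i a, ?_⟩
    have hne : ∀ j ∈ s, j ≠ i := fun j hj h => his (h ▸ hj)
    intro j hj l hl hjl
    rcases Finset.mem_insert.1 hj with rfl | hj' <;>
      rcases Finset.mem_insert.1 hl with rfl | hl'
    · exact absurd rfl hjl
    · simpa [Function.update_of_ne (hne l hl')] using ha l hl'
    · simpa [Function.update_of_ne (hne j hj')] using fun h => ha j hj' (hsymm _ _ h)
    · rw [Function.update_of_ne (hne j hj'), Function.update_of_ne (hne l hl')]
      exact fun h => hc j hj' l hl' hjl ⟨hne j hj', hne l hl', Or.inl h⟩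

theorem exists_choice_avoiding_matching_of_injective {ι α : Type*} [Finite ι]
    (g : ι × Bool → α) (hg : Function.Injective g) (R : α → α → Prop)
    (hsymm : ∀ x y, R x y → R y x) (hfun : ∀ x y z, R x y → R x z → y = z) :
    ∃ c : ι → Bool, ∀ i j, i ≠ j → ¬ R (g (i, c i)) (g (j, c j)) := by
  have := Fintype.ofFinite ι
  obtain ⟨c, hc⟩ := exists_choice_avoiding_matching Finset.univ (fun x y => R (g x) (g y))
    (fun _ _ => hsymm _ _) (fun _ _ _ h h' => hg (hfun _ _ _ h h'))
  exact ⟨c, fun i j => hc i (Finset.mem_univ _) j (Finset.mem_univ _)⟩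

/-- A graph of maximum degree at most two has a proper edge colouring with three colours. -/
theorem exists_edge_three_coloring {V : Type*} [Finite V] (J : SimpleGraph V)
    (hdeg : ∀ v (T : Finset V), (∀ x ∈ T, J.Adj v x) → T.card ≤ 2) :
    ∃ col : Sym2 V → Fin 3, ∀ x y z, J.Adj x y → J.Adj x z → y ≠ z →
      col s(x, y) ≠ col s(x, z) := by
  classical
  have := Fintype.ofFinite V
  have other : ∀ a b, J.Adj a b → ∃ a', ∀ z, J.Adj a z → z ≠ b → z = a' := by
    intro a b hab
    by_contra! hcon
    obtain ⟨y, hy, hyb, -⟩ := hcon b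
    obtain ⟨z, hz, hzb, hzy⟩ := hcon y
    have := hdeg a {b, y, z} (by simp [hab, hy, hz])
    rw [Finset.card_eq_three.2 ⟨b, y, z, hyb.symm, hzb.symm, hzy.symm, rfl⟩] at this
    omega
  suffices h : ∀ E : Finset (Sym2 V), ∃ col : Sym2 V → Fin 3, ∀ x y z, s(x, y) ∈ E →
      s(x, z) ∈ E → J.Adj x y → J.Adj x z → y ≠ z → col s(x, y) ≠ col s(x, z) by
    obtain ⟨col, hcol⟩ := h Finset.univ
    exact ⟨col, fun x y z => hcol x y z (Finset.mem_univ _) (Finset.mem_univ _)⟩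
  intro E
  induction E using Finset.induction_on with
  | empty => exact ⟨fun _ => 0, by simp⟩
  | insert e E heE ih =>
    obtain ⟨col, hcol⟩ := ih
    have key : ∃ i, ∀ x y z, s(x, y) = e → J.Adj x y → J.Adj x z → y ≠ z → col s(x, z) ≠ i := by
      induction e using Sym2.ind with
      | _ a b =>
      by_cases hab : J.Adj a b
      · obtain ⟨a', ha'⟩ := other a b hab
        obtain ⟨b', hb'⟩ := other b a hab.symm
        obtain ⟨i, h1, h2⟩ : ∃ i : Fin 3, col s(a, a') ≠ i ∧ col s(b, b') ≠ i := by
          generalize col s(a, a') = p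
          generalize col s(b, b') = q
          revert p q
          decide
        refine ⟨i, ?_⟩
        intro x y z hxy hJ hJ' hyz
        rcases Sym2.eq_iff.1 hxy with ⟨rfl, rfl⟩ | ⟨rfl, rfl⟩
        · rwa [ha' z hJ' hyz.symm]
        · rwa [hb' z hJ' hyz.symm]
      · refine ⟨0, ?_⟩
        intro x y z hxy hJ
        rcases Sym2.eq_iff.1 hxy with ⟨rfl, rfl⟩ | ⟨rfl, rfl⟩
        · exact absurd hJ hab
        · exact absurd hJ.symm hab
    obtain ⟨i, hi⟩ := key
    refine ⟨Function.update col e i, ?_⟩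
    intro x y z hy hz hJy hJz hyz
    have hne : s(x, y) ≠ s(x, z) := fun h => hyz (Sym2.congr_right.1 h)
    by_cases h1 : s(x, y) = e
    · have h2 : s(x, z) ≠ e := fun h => hne (h1.trans h.symm)
      rw [h1, Function.update_self, Function.update_of_ne h2]
      exact (hi x y z h1 hJy hJz hyz).symm
    · rw [Function.update_of_ne h1]
      by_cases h2 : s(x, z) = e
      · rw [h2, Function.update_self]
        exact hi x z y h2 hJz hJy hyz.symm
      · rw [Function.update_of_ne h2]
        exact hcol x y z (Finset.mem_of_mem_insert_of_ne hy h1)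
          (Finset.mem_of_mem_insert_of_ne hz h2) hJy hJz hyz

/-- Disjoint parts of size at least eight in a graph of maximum degree at most two have an
independent transversal. -/
theorem exists_independent_transversal {V ι : Type*} [Finite V] [Finite ι] (J : SimpleGraph V)
    (hdeg : ∀ v (T : Finset V), (∀ x ∈ T, J.Adj v x) → T.card ≤ 2)
    (P : ι → Finset V) (hcard : ∀ i, 8 ≤ (P i).card)
    (hdisj : ∀ i j, i ≠ j → Disjoint (P i) (P j)) :
    ∃ t : ι → V, (∀ i, t i ∈ P i) ∧ ∀ i j, i ≠ j → ¬ J.Adj (t i) (t j) := by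
  classical
  obtain ⟨col, hcol⟩ := exists_edge_three_coloring J hdeg
  have hemb : ∀ i, Nonempty (Bool × Bool × Bool ↪ P i) := fun i =>
    Function.Embedding.nonempty_of_card_le (by simpa using hcard i)
  obtain ⟨f, hfP, hfinj⟩ : ∃ f : ι → Bool × Bool × Bool → V,
      (∀ i b, f i b ∈ P i) ∧ ∀ i, Function.Injective (f i) :=
    ⟨fun i b => (hemb i).some b, fun i b => ((hemb i).some b).2,
      fun i _ _ h => (hemb i).some.injective (Subtype.ext h)⟩
  have hf : ∀ i b j b', f i b = f j b' → i = j ∧ b = b' := by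
    intro i b j b' h
    have hij : i = j := by
      by_contra hij
      exact Finset.disjoint_left.1 (hdisj i j hij) (hfP i b) (h ▸ hfP j b')
    subst hij
    exact ⟨rfl, hfinj i h⟩
  let R : Fin 3 → V → V → Prop := fun n x y => J.Adj x y ∧ col s(x, y) = n
  have hsymm : ∀ n x y, R n x y → R n y x := fun n x y h => ⟨h.1.symm, by rw [Sym2.eq_swap, h.2]⟩
  have hfun : ∀ n x y z, R n x y → R n x z → y = z := by
    intro n x y z h h'
    by_contra hyz
    exact hcol x y z h.1 h'.1 hyz (h.2.trans h'.2.symm)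
  obtain ⟨c₀, h₀⟩ := exists_choice_avoiding_matching_of_injective
    (fun p : (ι × Bool × Bool) × Bool => f p.1.1 (p.1.2.1, p.1.2.2, p.2))
    (by
      rintro ⟨⟨i, a, b⟩, c⟩ ⟨⟨j, a', b'⟩, c'⟩ h
      simpa [and_assoc] using hf _ _ _ _ h) (R 0) (hsymm 0) (hfun 0)
  obtain ⟨c₁, h₁⟩ := exists_choice_avoiding_matching_of_injective
    (fun p : (ι × Bool) × Bool => f p.1.1 (p.1.2, p.2, c₀ (p.1.1, p.1.2, p.2)))
    (by
      rintro ⟨⟨i, a⟩, b⟩ ⟨⟨j, a'⟩, b'⟩ h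
      have := hf _ _ _ _ h
      simp only [Prod.mk.injEq] at this ⊢
      tauto) (R 1) (hsymm 1) (hfun 1)
  obtain ⟨c₂, h₂⟩ := exists_choice_avoiding_matching_of_injective
    (fun p : ι × Bool => f p.1 (p.2, c₁ (p.1, p.2), c₀ (p.1, p.2, c₁ (p.1, p.2))))
    (by
      rintro ⟨i, a⟩ ⟨j, a'⟩ h
      have := hf _ _ _ _ h
      simp only [Prod.mk.injEq] at this ⊢
      tauto) (R 2) (hsymm 2) (hfun 2)
  refine ⟨fun i => f i (c₂ i, c₁ (i, c₂ i), c₀ (i, c₂ i, c₁ (i, c₂ i))), fun i => hfP _ _, ?_⟩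
  intro i j hij hJ
  have a₀ := h₀ (i, c₂ i, c₁ (i, c₂ i)) (j, c₂ j, c₁ (j, c₂ j)) (by simp [hij])
  have a₁ := h₁ (i, c₂ i) (j, c₂ j) (by simp [hij])
  have a₂ := h₂ i j hij
  have hn : ∀ n : Fin 3, n = 0 ∨ n = 1 ∨ n = 2 := by decide
  rcases hn (col s(f i (c₂ i, c₁ (i, c₂ i), c₀ (i, c₂ i, c₁ (i, c₂ i))),
    f j (c₂ j, c₁ (j, c₂ j), c₀ (j, c₂ j, c₁ (j, c₂ j))))) with h | h | h
  · exact a₀ ⟨hJ, h⟩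
  · exact a₁ ⟨hJ, h⟩
  · exact a₂ ⟨hJ, h⟩

/-- `c` is a proper colouring of the subgraph induced on `A`. -/
def ProperOn {V α : Type*} (G : SimpleGraph V) (c : V → α) (A : Finset V) : Prop :=
  ∀ x ∈ A, ∀ y ∈ A, G.Adj x y → c x ≠ c y

theorem ProperOn.mono {V α : Type*} {G : SimpleGraph V} {c : V → α} {A B : Finset V}
    (hc : ProperOn G c B) (h : A ⊆ B) : ProperOn G c A :=
  fun x hx y hy => hc x (h hx) y (h hy)

theorem ProperOn.update {V α : Type*} [DecidableEq V] {G : SimpleGraph V} {c : V → α}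
    {A : Finset V} (hc : ProperOn G c A) {a : V} {i : α} (ha : a ∉ A)
    (hi : ∀ x ∈ A, G.Adj a x → c x ≠ i) :
    ProperOn G (Function.update c a i) (insert a A) := by
  have hne : ∀ x ∈ A, x ≠ a := fun x hx h => ha (h ▸ hx)
  intro x hx y hy hxy
  rcases Finset.mem_insert.1 hx with rfl | hx' <;> rcases Finset.mem_insert.1 hy with rfl | hy'
  · exact absurd hxy (G.irrefl)
  · rw [Function.update_self, Function.update_of_ne (hne y hy')]
    exact (hi y hy' hxy).symm
  · rw [Function.update_self, Function.update_of_ne (hne x hx')]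
    exact hi x hx' hxy.symm
  · rw [Function.update_of_ne (hne x hx'), Function.update_of_ne (hne y hy')]
    exact hc x hx' y hy' hxy

/-- A colouring extends to a vertex when fewer than `k` vertices account for all the colours
of its coloured neighbours. -/
theorem ProperOn.exists_insert {V : Type*} [DecidableEq V] {G : SimpleGraph V} {k : ℕ}
    {c : V → Fin k} {A : Finset V} (hc : ProperOn G c A)
    {a : V} (ha : a ∉ A) (T : Finset V) (hT : T.card < k)
    (hcol : ∀ x ∈ A, G.Adj a x → c x ∈ T.image c) :
    ∃ c' : V → Fin k, ProperOn G c' (insert a A) ∧ ∀ x ∈ A, c' x = c x := by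
  obtain ⟨i, hi⟩ : ∃ i, i ∉ T.image c := by
    by_contra! hcon
    have h1 : (Finset.univ : Finset (Fin k)).card ≤ (T.image c).card :=
      Finset.card_le_card fun i _ => hcon i
    have h2 := Finset.card_image_le (s := T) (f := c)
    simp at h1
    omega
  refine ⟨Function.update c a i, hc.update ha fun x hx hax h => hi (h ▸ hcol x hx hax), ?_⟩
  exact fun x hx => Function.update_of_ne (fun h => ha (by rwa [h] at hx)) _ _

theorem ProperOn.exists_insert_of_adj {V : Type*} [DecidableEq V] {G : SimpleGraph V} {k : ℕ}
    (hdeg : ∀ v (T : Finset V), (∀ x ∈ T, G.Adj v x) → T.card ≤ k)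
    {c : V → Fin k} {A : Finset V} (hc : ProperOn G c A)
    {a z : V} (ha : a ∉ A) (hz : z ∉ A) (haz : G.Adj a z) :
    ∃ c' : V → Fin k, ProperOn G c' (insert a A) ∧ ∀ x ∈ A, c' x = c x := by
  classical
  refine hc.exists_insert ha (A.filter (G.Adj a)) ?_ ?_
  · have := hdeg a (insert z (A.filter (G.Adj a))) (by
      intro x hx
      rcases Finset.mem_insert.1 hx with rfl | hx
      · exact haz
      · exact (Finset.mem_filter.1 hx).2)
    rw [Finset.card_insert_of_notMem (by simp [hz])] at this
    omega
  · exact fun x hx hax => Finset.mem_image_of_mem _ (by simp [hx, hax])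

theorem ProperOn.exists_insert_of_eq {V : Type*} [DecidableEq V] {G : SimpleGraph V} {k : ℕ}
    (hdeg : ∀ v (T : Finset V), (∀ x ∈ T, G.Adj v x) → T.card ≤ k)
    {c : V → Fin k} {A : Finset V} (hc : ProperOn G c A)
    {a p q : V} (ha : a ∉ A) (hp : p ∈ A) (hq : q ∈ A) (hpq : p ≠ q) (hap : G.Adj a p)
    (haq : G.Adj a q) (hcpq : c p = c q) :
    ∃ c' : V → Fin k, ProperOn G c' (insert a A) ∧ ∀ x ∈ A, c' x = c x := by
  classical
  refine hc.exists_insert ha ((A.filter (G.Adj a)).erase p) ?_ ?_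
  · have h1 := hdeg a (A.filter (G.Adj a)) (by simp)
    have h2 : p ∈ A.filter (G.Adj a) := by simp [hp, hap]
    have := Finset.card_erase_lt_of_mem h2
    omega
  · intro x hx hax
    by_cases hxp : x = p
    · rw [hxp, hcpq]
      exact Finset.mem_image_of_mem _ (by simp [hpq.symm, hq, haq])
    · exact Finset.mem_image_of_mem _ (by simp [hxp, hx, hax])

/-- Greedy colouring along a path whose final vertex remains uncoloured. -/
theorem ProperOn.exists_of_isChain {V : Type*} [DecidableEq V] {G : SimpleGraph V} {k : ℕ}
    (hdeg : ∀ v (T : Finset V), (∀ x ∈ T, G.Adj v x) → T.card ≤ k) (l : List V) {z : V}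
    {c : V → Fin k} {A : Finset V} (hc : ProperOn G c A) (hl : (l ++ [z]).IsChain G.Adj)
    (hnd : (l ++ [z]).Nodup) (hA : ∀ x ∈ l ++ [z], x ∉ A) :
    ∃ c' : V → Fin k, ProperOn G c' (A ∪ l.toFinset) ∧ ∀ x ∈ A, c' x = c x := by
  induction l generalizing c A with
  | nil => exact ⟨c, by simpa using hc, fun _ _ => rfl⟩
  | cons a l ih =>
    obtain ⟨b, m, hbm⟩ : ∃ b m, l ++ [z] = b :: m := by
      cases l with
      | nil => exact ⟨z, [], rfl⟩
      | cons b m => exact ⟨b, m ++ [z], rfl⟩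
    have hb : b ∈ l ++ [z] := by simp [hbm]
    have hab : G.Adj a b := by
      rw [List.cons_append, hbm] at hl
      exact (List.isChain_cons_cons.1 hl).1
    rw [List.cons_append, List.nodup_cons] at hnd
    obtain ⟨c₁, hc₁, he₁⟩ := hc.exists_insert_of_adj hdeg (hA a (by simp))
      (hA b (List.mem_cons_of_mem _ hb)) hab
    obtain ⟨c₂, hc₂, he₂⟩ := ih hc₁ (by simpa using hl.tail) hnd.2 (by
      intro x hx hxA
      rcases Finset.mem_insert.1 hxA with rfl | hxA
      · exact hnd.1 hx
      · exact hA x (List.mem_cons_of_mem _ hx) hxA)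
    refine ⟨c₂, ?_, fun x hx => (he₂ x (Finset.mem_insert_of_mem hx)).trans (he₁ x hx)⟩
    convert hc₂ using 1
    ext x
    simp

theorem List.exists_eq_append_cons_forall_not {α : Type*} (p : α → Prop) :
    ∀ l : List α, (∃ a ∈ l, p a) → ∃ l₁ a l₂, l = l₁ ++ a :: l₂ ∧ p a ∧ ∀ b ∈ l₁, ¬ p b
  | [], h => by simp at h
  | x :: l, h => by
    by_cases hx : p x
    · exact ⟨[], x, l, rfl, hx, by simp⟩
    · obtain ⟨l₁, a, l₂, rfl, ha, hb⟩ := List.exists_eq_append_cons_forall_not p l (by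
        obtain ⟨a, ha, hpa⟩ := h
        rcases List.mem_cons.1 ha with rfl | ha
        · exact absurd hpa hx
        · exact ⟨a, ha, hpa⟩)
      refine ⟨x :: l₁, a, l₂, rfl, ha, ?_⟩
      intro b hb'
      rcases List.mem_cons.1 hb' with rfl | hb'
      · exact hx
      · exact hb b hb'

theorem List.exists_eq_append_cons_forall_not_right {α : Type*} (p : α → Prop) (l : List α)
    (h : ∃ a ∈ l, p a) : ∃ l₁ a l₂, l = l₁ ++ a :: l₂ ∧ p a ∧ ∀ b ∈ l₂, ¬ p b := by
  obtain ⟨l₁, a, l₂, hl, ha, hb⟩ :=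
    List.exists_eq_append_cons_forall_not p l.reverse (by simpa using h)
  refine ⟨l₂.reverse, a, l₁.reverse, ?_, ha, by simpa using hb⟩
  rw [← List.reverse_reverse l, hl]
  simp

/-- A graph with a spanning path whose first and third vertices are nonadjacent, and whose second
vertex has a neighbour further along the path, is colourable with as many colours as its
maximum degree. -/
theorem exists_properOn_of_spanning_path {V : Type*} [DecidableEq V] {G : SimpleGraph V} {k : ℕ}
    (hdeg : ∀ v (T : Finset V), (∀ x ∈ T, G.Adj v x) → T.card ≤ k) (hk : 0 < k)
    {S : Finset V} {q : List V} {x y w z : V} (hch : (q ++ [y, w, x]).IsChain G.Adj)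
    (hnd : (q ++ [y, w, x]).Nodup) (hspan : ∀ a ∈ S, a ∈ q ++ [y, w, x])
    (hwx : G.Adj w x) (hwy : G.Adj w y) (hxy : x ≠ y) (hnxy : ¬ G.Adj x y)
    (hzq : z ∈ q) (hwz : G.Adj w z) :
    ∃ c : V → Fin k, ProperOn G c S := by
  obtain ⟨q₁, q₂, rfl⟩ := List.append_of_mem hzq
  obtain ⟨c₁, hc₁, he₁⟩ := ProperOn.exists_of_isChain hdeg q₂.reverse (z := z)
    (c := fun _ => ⟨0, hk⟩) (A := {x, y}) (by
      intro a ha b hb hab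
      simp only [Finset.mem_insert, Finset.mem_singleton] at ha hb
      rcases ha with rfl | rfl <;> rcases hb with rfl | rfl
      · exact absurd hab G.irrefl
      · exact absurd hab hnxy
      · exact absurd hab.symm hnxy
      · exact absurd hab G.irrefl)
    (by
      rw [← List.reverse_cons, List.isChain_reverse]
      rw [List.append_assoc] at hch
      exact (hch.right_of_append.left_of_append).imp fun _ _ h => h.symm)
    (by
      rw [← List.reverse_cons, List.nodup_reverse]
      exact hnd.of_append_left.of_append_right)
    (by
      intro a ha
      have ha' : a ∈ z :: q₂ := by simpa [or_comm] using ha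
      simp only [List.nodup_append, List.mem_append] at hnd
      have := hnd.2.2 a (Or.inr ha')
      simp only [Finset.mem_insert, Finset.mem_singleton]
      rintro (rfl | rfl)
      · exact this a (by simp) rfl
      · exact this a (by simp) rfl)
  obtain ⟨c₂, hc₂, he₂⟩ := hc₁.exists_of_isChain hdeg (q₁ ++ [z]) (z := w)
    (by
      rw [List.append_assoc]
      refine List.isChain_split.2 ⟨?_, by simpa using hwz.symm⟩
      rw [List.append_assoc] at hch
      exact (List.isChain_split.1 hch).1)
    (by
      simp [List.nodup_append] at hnd ⊢
      clear * - hnd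
      grind)
    (by
      simp [List.nodup_append] at hnd ⊢
      clear * - hnd
      grind)
  obtain ⟨c₃, hc₃, -⟩ := hc₂.exists_insert_of_eq hdeg (a := w) (p := x) (q := y)
    (by
      simp [List.nodup_append] at hnd ⊢
      clear * - hnd
      grind) (by simp) (by simp) hxy hwx hwy
    (by rw [he₂ x (by simp), he₂ y (by simp), he₁ x (by simp), he₁ y (by simp)])
  refine ⟨c₃, hc₃.mono ?_⟩
  intro a ha
  have := hspan a ha
  simp at this ⊢
  tauto

/-- A colouring extends to a cycle having a vertex with all its neighbours on the cycle and
another vertex with a neighbour off the cycle. -/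
theorem ProperOn.exists_of_cycle {V : Type*} [DecidableEq V] {G : SimpleGraph V} {k : ℕ}
    (hdeg : ∀ v (T : Finset V), (∀ x ∈ T, G.Adj v x) → T.card ≤ k)
    {S : Finset V} {C l : List V} {h e : V} {c : V → Fin k} (hc : ProperOn G c (S \ C.toFinset))
    (hC : C = h :: (l ++ [e])) (hCch : C.IsChain G.Adj) (hCnd : C.Nodup)
    (hhe : G.Adj h e) (hhout : ∀ a ∈ S \ C.toFinset, ¬ G.Adj h a)
    (hex : ∃ a ∈ C, ∃ u ∈ S \ C.toFinset, G.Adj a u) :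
    ∃ c : V → Fin k, ProperOn G c S := by
  obtain ⟨D, a, C₂, hCD, ⟨u, hu, hau⟩, hD⟩ := List.exists_eq_append_cons_forall_not
    (fun a => ∃ u ∈ S \ C.toFinset, G.Adj a u) C hex
  obtain ⟨C₁, b, rfl⟩ : ∃ C₁ b, D = C₁ ++ [b] := by
    rcases List.eq_nil_or_concat D with rfl | ⟨C₁, b, rfl⟩
    · rw [hC, List.nil_append, List.cons.injEq] at hCD
      rw [← hCD.1] at hau
      exact absurd hau (hhout u hu)
    · exact ⟨C₁, b, by simp⟩
  have hb : ∀ v ∈ S \ C.toFinset, ¬ G.Adj b v := fun v hv hbv =>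
    hD b (by simp) ⟨v, hv, hbv⟩
  have hba : G.Adj b a := by
    rw [hCD, List.append_assoc] at hCch
    exact (List.isChain_cons_cons.1 hCch.right_of_append).1
  have hbC : b ∈ C := by simp [hCD]
  have hbS : b ∉ S \ C.toFinset := by simp [hbC]
  have hc₁ := hc.update (i := c u) hbS fun v hv hbv => absurd hbv (hb v hv)
  have hub : u ≠ b := fun h => hbS (h ▸ hu)
  obtain ⟨c₂, hc₂, he₂⟩ := hc₁.exists_of_isChain hdeg (C₁.reverse ++ C₂.reverse) (z := a)
    (by
      have h1 : C₁.reverse ++ C₂.reverse ++ [a] = ((a :: C₂) ++ C₁).reverse := by simp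
      rw [h1, List.isChain_reverse]
      refine List.IsChain.imp (R := G.Adj) (fun _ _ h => h.symm) ?_
      rw [hCD, List.append_assoc] at hCch
      refine hCch.right_of_append.tail.append hCch.left_of_append ?_
      intro v hv w' hw'
      have e1 : v = e := by
        have h2 : C.getLast? = some e := by simp [hC, List.getLast?_cons]
        rw [hCD, List.getLast?_append] at h2
        simp at hv h2
        grind
      have e2 : w' = h := by
        have h2 : C.head? = some h := by simp [hC]
        rw [hCD] at h2
        cases C₁ with
        | nil => simp at hw'
        | cons _ _ => simp_all
      rw [e1, e2]
      exact hhe.symm)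
    (by
      rw [hCD] at hCnd
      simp [List.nodup_append] at hCnd ⊢
      clear * - hCnd
      grind)
    (by
      rw [hCD] at hCnd ⊢
      simp [List.nodup_append] at hCnd ⊢
      clear * - hCnd
      grind)
  obtain ⟨c₃, hc₃, -⟩ := hc₂.exists_insert_of_eq hdeg (a := a) (p := b) (q := u)
    (by
      rw [hCD] at hCnd ⊢
      simp [List.nodup_append] at hCnd ⊢
      clear * - hCnd
      grind) (by simp) (Finset.mem_union_left _ (Finset.mem_insert_of_mem hu)) hub.symm hba.symm hau
    (by
      rw [he₂ b (by simp), he₂ u (Finset.mem_insert_of_mem hu), Function.update_self,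
        Function.update_of_ne hub])
  refine ⟨c₃, hc₃.mono ?_⟩
  intro v hv
  by_cases hvC : v ∈ C
  · rw [hCD] at hvC
    simp at hvC ⊢
    tauto
  · simp [hv, hvC]

/-- The theorem of Brooks: a graph with degrees and cliques bounded by `k ≥ 3` is `k`-colourable. -/
theorem exists_properOn_of_degree_le_of_clique_le {V : Type*} (G : SimpleGraph V) {k : ℕ}
    (hk : 3 ≤ k) (hdeg : ∀ v (T : Finset V), (∀ x ∈ T, G.Adj v x) → T.card ≤ k)
    (hclique : ∀ T : Finset V, G.IsClique (T : Set V) → T.card ≤ k) (S : Finset V) :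
    ∃ c : V → Fin k, ProperOn G c S := by
  classical
  induction S using Finset.strongInduction with
  | H S ih =>
  rcases S.eq_empty_or_nonempty with rfl | ⟨w, hw⟩
  · exact ⟨fun _ => ⟨0, by omega⟩, by simp [ProperOn]⟩
  by_cases hlow : ∃ v ∈ S, (S.filter (G.Adj v)).card < k
  · obtain ⟨v, hv, hvk⟩ := hlow
    obtain ⟨c, hc⟩ := ih _ (Finset.erase_ssubset hv)
    obtain ⟨c', hc', -⟩ := hc.exists_insert (Finset.notMem_erase v S) _ hvk (by
      intro x hx hvx
      exact Finset.mem_image_of_mem _ (by simp [Finset.mem_of_mem_erase hx, hvx]))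
    exact ⟨c', by rwa [Finset.insert_erase hv] at hc'⟩
  push Not at hlow
  obtain ⟨x, hx, y, hy, hwx, hwy, hxy, hnxy⟩ : ∃ x ∈ S, ∃ y ∈ S, G.Adj w x ∧ G.Adj w y ∧ x ≠ y ∧
      ¬ G.Adj x y := by
    by_contra! hcon
    have hcl : G.IsClique (insert w (S.filter (G.Adj w)) : Finset V) := by
      intro a ha b hb hab
      simp only [Finset.coe_insert, Finset.coe_filter, Set.mem_insert_iff,
        Set.mem_ofPred_eq] at ha hb
      rcases ha with rfl | ha <;> rcases hb with rfl | hb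
      · exact absurd rfl hab
      · exact hb.2
      · exact ha.2.symm
      · exact hcon a ha.1 b hb.1 ha.2 hb.2 hab
    have h1 := hclique _ hcl
    rw [Finset.card_insert_of_notMem (by simp)] at h1
    have := hlow w hw
    omega
  -- a longest path ending in `y, w, x`
  let Q : ℕ → Prop := fun n => ∃ q : List V, q.length = n ∧ (q ++ [y, w, x]).IsChain G.Adj ∧
    (q ++ [y, w, x]).Nodup ∧ ∀ a ∈ q ++ [y, w, x], a ∈ S
  have hQ0 : Q 0 := by
    refine ⟨[], rfl, ?_, ?_, ?_⟩
    · simp [hwx, hwy.symm]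
    · simp [hwx.ne, hwy.ne', hxy.symm]
    · simp [hx, hy, hw]
  have hQle : ∀ n, Q n → n ≤ S.card := by
    rintro n ⟨q, rfl, -, hnd, hS⟩
    have h1 : (q ++ [y, w, x]).toFinset ⊆ S := fun a ha => hS a (List.mem_toFinset.1 ha)
    have h2 := Finset.card_le_card h1
    rw [List.toFinset_card_of_nodup hnd] at h2
    simp at h2
    omega
  obtain ⟨n, ⟨q, hqn, hch, hnd, hqS⟩, hmax⟩ : ∃ n, Q n ∧ ∀ m, Q m → m ≤ n :=
    ⟨Nat.findGreatest Q S.card, Nat.findGreatest_spec (Nat.zero_le _) hQ0,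
      fun m hm => Nat.le_findGreatest (hQle m hm) hm⟩
  obtain ⟨h, t, hp⟩ : ∃ h t, q ++ [y, w, x] = h :: t := by
    cases q with
    | nil => exact ⟨_, _, rfl⟩
    | cons h t => exact ⟨h, _, rfl⟩
  have hend : ∀ a ∈ S, G.Adj h a → a ∈ q ++ [y, w, x] := by
    intro a ha hha
    by_contra hcon
    have := hmax (n + 1) ⟨a :: q, by simp [hqn], ?_, ?_, ?_⟩
    · omega
    · rw [List.cons_append, hp]
      rw [hp] at hch
      exact List.isChain_cons_cons.2 ⟨hha.symm, hch⟩
    · rw [List.cons_append]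
      exact List.nodup_cons.2 ⟨hcon, hnd⟩
    · intro b hb
      rw [List.cons_append] at hb
      rcases List.mem_cons.1 hb with rfl | hb
      · exact ha
      · exact hqS b hb
  by_cases hspan : ∀ a ∈ S, a ∈ q ++ [y, w, x]
  · -- the path covers everything
    obtain ⟨z, hz, hwz, hzx, hzy⟩ : ∃ z ∈ S, G.Adj w z ∧ z ≠ x ∧ z ≠ y := by
      by_contra! hcon
      have h1 : S.filter (G.Adj w) ⊆ {x, y} := by
        intro a ha
        have ha := Finset.mem_filter.1 ha
        by_cases hax : a = x
        · simp [hax]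
        · simp [hcon a ha.1 ha.2 hax]
      have := (Finset.card_le_card h1).trans Finset.card_le_two
      have := hlow w hw
      omega
    have hzq : z ∈ q := by
      have := hspan z hz
      simpa [hzx, hzy, hwz.ne'] using this
    exact exists_properOn_of_spanning_path hdeg (by omega) hch hnd hspan hwx hwy hxy hnxy hzq hwz
  · -- the neighbours of the end of the path lie on a cycle
    push Not at hspan
    obtain ⟨o, hoS, hop⟩ := hspan
    rw [hp] at hch hnd hqS hend hop
    have hhS : h ∈ S := hqS h (by simp)
    have hht : ∀ a ∈ S, G.Adj h a → a ∈ t := fun a ha hha =>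
      (List.mem_cons.1 (hend a ha hha)).resolve_left hha.ne'
    obtain ⟨l₁, e, l₂, rfl, hhe, hl₂⟩ := List.exists_eq_append_cons_forall_not_right (G.Adj h) t (by
      obtain ⟨a, ha⟩ : (S.filter (G.Adj h)).Nonempty := by
        have := hlow h hhS
        exact Finset.card_pos.1 (by omega)
      have ha := Finset.mem_filter.1 ha
      exact ⟨a, hht a ha.1 ha.2, ha.2⟩)
    obtain ⟨C, hC⟩ : ∃ C, C = h :: (l₁ ++ [e]) := ⟨_, rfl⟩
    have hpC : h :: (l₁ ++ e :: l₂) = C ++ l₂ := by simp [hC]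
    rw [hpC] at hch hnd hqS hop
    have hCch : C.IsChain G.Adj := hch.left_of_append
    have hCnd : C.Nodup := hnd.of_append_left
    have hCS : C.toFinset ⊆ S := fun a ha =>
      hqS a (List.mem_append_left _ (List.mem_toFinset.1 ha))
    have hhout : ∀ a ∈ S \ C.toFinset, ¬ G.Adj h a := by
      intro a ha hha
      rw [Finset.mem_sdiff, List.mem_toFinset] at ha
      have h1 := hht a ha.1 hha
      refine hl₂ a ?_ hha
      simp only [hC] at ha
      grind
    have hout : S \ C.toFinset ⊂ S := by
      refine Finset.sdiff_ssubset hCS ⟨h, by simp [hC]⟩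
    obtain ⟨c, hc⟩ := ih _ hout
    by_cases hex : ∃ a ∈ C, ∃ u ∈ S \ C.toFinset, G.Adj a u
    · exact hc.exists_of_cycle hdeg hC hCch hCnd hhe hhout hex
    · push Not at hex
      obtain ⟨c', hc'⟩ := ih C.toFinset
        (Finset.ssubset_iff_subset_ne.2 ⟨hCS, fun h => hop (by
          rw [← h, List.mem_toFinset] at hoS
          exact List.mem_append_left _ hoS)⟩)
      refine ⟨fun v => if v ∈ C then c' v else c v, ?_⟩
      intro v hv v' hv' hadj
      by_cases h1 : v ∈ C <;> by_cases h2 : v' ∈ C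
      · simpa [h1, h2] using hc' v (by simpa) v' (by simpa) hadj
      · exact absurd hadj (hex v h1 v' (by simp [hv', h2]))
      · exact absurd hadj.symm (hex v' h2 v (by simp [hv, h1]))
      · simpa [h1, h2] using hc v (by simp [hv, h1]) v' (by simp [hv', h2]) hadj

theorem SimpleGraph.IsClique.adj_of_mem {V : Type*} {G : SimpleGraph V} {A : Finset V}
    (hA : G.IsClique (A : Set V)) {x y : V} (hx : x ∈ A) (hy : y ∈ A) (hxy : x ≠ y) : G.Adj x y :=
  hA (by simpa using hx) (by simpa using hy) hxy

theorem card_le_of_common_vertex {V : Type*} [DecidableEq V] {G : SimpleGraph V} {w : ℕ}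
    (hdeg : ∀ v (T : Finset V), (∀ x ∈ T, G.Adj v x) → T.card ≤ w + 1) {v : V} {T : Finset V}
    (hT : ∀ x ∈ T, x ≠ v → G.Adj v x) : T.card ≤ w + 2 := by
  have h1 := hdeg v (T.erase v) fun x hx =>
    hT x (Finset.mem_of_mem_erase hx) (Finset.ne_of_mem_erase hx)
  have h2 := Finset.pred_card_le_card_erase (s := T) (a := v)
  omega

theorem card_le_card_inter_add_two {V : Type*} [DecidableEq V] {G : SimpleGraph V} {w : ℕ}
    (hdeg : ∀ v (T : Finset V), (∀ x ∈ T, G.Adj v x) → T.card ≤ w + 1) {A B : Finset V}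
    (hA : G.IsNClique w A) (hB : G.IsNClique w B) (hAB : ¬ Disjoint A B) :
    w ≤ (A ∩ B).card + 2 := by
  obtain ⟨v, hvA, hvB⟩ := Finset.not_disjoint_iff.1 hAB
  have h1 := card_le_of_common_vertex hdeg (v := v) (T := A ∪ B) (by
    intro x hx hxv
    rcases Finset.mem_union.1 hx with hx | hx
    · exact hA.1.adj_of_mem hvA hx hxv.symm
    · exact hB.1.adj_of_mem hvB hx hxv.symm)
  have h2 := Finset.card_union_add_card_inter A B
  have := hA.2
  have := hB.2
  omega

theorem not_disjoint_of_common_clique {V : Type*} [DecidableEq V] {G : SimpleGraph V} {w : ℕ}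
    (hw : 5 ≤ w)
    (hdeg : ∀ v (T : Finset V), (∀ x ∈ T, G.Adj v x) → T.card ≤ w + 1) {A B C : Finset V}
    (hA : G.IsNClique w A) (hB : G.IsNClique w B) (hC : G.IsNClique w C)
    (hAB : ¬ Disjoint A B) (hAC : ¬ Disjoint A C) : ¬ Disjoint B C := by
  intro h
  have h1 := card_le_card_inter_add_two hdeg hA hB hAB
  have h2 := card_le_card_inter_add_two hdeg hA hC hAC
  have h3 : Disjoint (A ∩ B) (A ∩ C) :=
    h.mono Finset.inter_subset_right Finset.inter_subset_right
  have h4 := Finset.card_le_card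
    (Finset.union_subset (Finset.inter_subset_left (s₁ := A) (s₂ := B))
      (Finset.inter_subset_left (s₁ := A) (s₂ := C)))
  rw [Finset.card_union_of_disjoint h3] at h4
  have := hA.2
  omega

/-- A Hajnal-type inequality for a family of pairwise intersecting maximum cliques. -/
theorem card_inf_add_card_sup_ge {V : Type*} [DecidableEq V] {G : SimpleGraph V} {w : ℕ}
    (hw : 5 ≤ w)
    (hdeg : ∀ v (T : Finset V), (∀ x ∈ T, G.Adj v x) → T.card ≤ w + 1)
    (hclique : ∀ T : Finset V, G.IsClique (T : Set V) → T.card ≤ w) {A : Finset V}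
    (hA : G.IsNClique w A) (S : Finset (Finset V))
    (hS : ∀ B ∈ S, G.IsNClique w B ∧ ¬ Disjoint A B) :
    w ≤ (A.filter fun x => ∀ B ∈ S, x ∈ B).card + 2 ∧
      2 * w ≤ (A.filter fun x => ∀ B ∈ S, x ∈ B).card + (A ∪ S.biUnion id).card := by
  induction S using Finset.induction_on with
  | empty =>
    have := hA.2
    simp only [Finset.notMem_empty, false_imp_iff, implies_true, Finset.filter_true,
      Finset.biUnion_empty, Finset.union_empty]
    omega
  | insert B S hBS ih =>
    obtain ⟨h1, h2⟩ := ih fun C hC => hS C (Finset.mem_insert_of_mem hC)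
    obtain ⟨hB, hAB⟩ := hS B (Finset.mem_insert_self _ _)
    set D := A.filter fun x => ∀ B ∈ S, x ∈ B with hD
    set F := A ∪ S.biUnion id with hF
    have hD' : (A.filter fun x => ∀ C ∈ insert B S, x ∈ C) = D ∩ B := by
      ext x
      simp only [hD, Finset.mem_filter, Finset.mem_inter, Finset.forall_mem_insert]
      tauto
    have hF' : A ∪ (insert B S).biUnion id = F ∪ B := by
      ext x
      simp only [hF, Finset.mem_union, Finset.biUnion_insert, id]
      tauto
    rw [hD', hF']
    have hDF : ∀ x ∈ D, ∀ y ∈ F, x ≠ y → G.Adj x y := by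
      intro x hx y hy hxy
      rw [hD, Finset.mem_filter] at hx
      rw [hF, Finset.mem_union, Finset.mem_biUnion] at hy
      rcases hy with hy | ⟨C, hC, hy⟩
      · exact hA.1.adj_of_mem hx.1 hy hxy
      · exact (hS C (Finset.mem_insert_of_mem hC)).1.1.adj_of_mem (hx.2 C hC) hy hxy
    have hDsub : D ⊆ F := (Finset.filter_subset _ _).trans Finset.subset_union_left
    have h3 : (D ∪ B ∩ F).card ≤ w := by
      apply hclique
      intro x hx y hy hxy
      simp only [Finset.coe_union, Finset.coe_inter, Set.mem_union, Set.mem_inter_iff,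
        Finset.mem_coe] at hx hy
      rcases hx with hx | hx <;> rcases hy with hy | hy
      · exact hDF x hx y (hDsub hy) hxy
      · exact hDF x hx y hy.2 hxy
      · exact (hDF y hy x hx.2 hxy.symm).symm
      · exact hB.1.adj_of_mem hx.1 hy.1 hxy
    have h4 := Finset.card_union_add_card_inter D (B ∩ F)
    have h5 : D ∩ (B ∩ F) = D ∩ B := by
      ext x
      have := @hDsub x
      simp only [Finset.mem_inter]
      tauto
    rw [h5] at h4
    have h6 := Finset.card_union_add_card_inter F B
    rw [Finset.inter_comm F B] at h6
    have hBw := hB.2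
    have hAw := hA.2
    have h7 : 2 * w ≤ (D ∩ B).card + (F ∪ B).card := by omega
    refine ⟨?_, h7⟩
    have hne : (D ∩ B).Nonempty := by
      rw [← Finset.not_disjoint_iff_nonempty_inter]
      intro hdis
      have h8 := card_le_card_inter_add_two hdeg hA hB hAB
      have h9 := Finset.card_le_card
        (Finset.union_subset (Finset.filter_subset _ _ : D ⊆ A)
          (Finset.inter_subset_left (s₁ := A) (s₂ := B)))
      rw [Finset.card_union_of_disjoint (hdis.mono_right Finset.inter_subset_right)] at h9
      omega
    obtain ⟨v, hv⟩ := hne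
    rw [Finset.mem_inter] at hv
    have h10 := card_le_of_common_vertex hdeg (v := v) (T := F ∪ B) (by
      intro x hx hxv
      rcases Finset.mem_union.1 hx with hx | hx
      · exact hDF v hv.1 x hx hxv.symm
      · exact hB.1.adj_of_mem hv.2 hx hxv.symm)
    omega

/-- The theorem of King, for clique number at least `9`: if every degree is at most `w + 1` and every
clique has at most `w` vertices, some independent set meets all the cliques of size `w`. -/
theorem exists_isIndepSet_inter_isNClique {V : Type*} [Fintype V] (G : SimpleGraph V) {w : ℕ}
    (hw : 9 ≤ w)
    (hdeg : ∀ v (T : Finset V), (∀ x ∈ T, G.Adj v x) → T.card ≤ w + 1)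
    (hclique : ∀ T : Finset V, G.IsClique (T : Set V) → T.card ≤ w) :
    ∃ I : Finset V, (∀ x ∈ I, ∀ y ∈ I, ¬ G.Adj x y) ∧
      ∀ A, G.IsNClique w A → ∃ x ∈ I, x ∈ A := by
  classical
  rcases isEmpty_or_nonempty V with hV | hV
  · refine ⟨∅, by simp, fun A hA => ?_⟩
    have := hA.2
    rw [Finset.eq_empty_of_isEmpty A, Finset.card_empty] at this
    omega
  let N : Finset V → Finset (Finset V) := fun A =>
    Finset.univ.filter fun B => G.IsNClique w B ∧ ¬ Disjoint A B
  let D : Finset V → Finset V := fun A => A.filter fun x => ∀ B ∈ N A, x ∈ B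
  let F : Finset V → Finset V := fun A => A ∪ (N A).biUnion id
  have hHaj : ∀ A, G.IsNClique w A → w ≤ (D A).card + 2 ∧ 2 * w ≤ (D A).card + (F A).card :=
    fun A hA => by
      convert card_inf_add_card_sup_ge (by omega) hdeg hclique hA (N A) (by simp [N])
  have hDA : ∀ A, D A ⊆ A := fun A => Finset.filter_subset _ _
  have hself : ∀ A, G.IsNClique w A → ¬ Disjoint A A := by
    intro A hA h
    have := hA.2
    rw [disjoint_self.1 h] at this
    simp at this
    omega
  have hNeq : ∀ A B, G.IsNClique w A → G.IsNClique w B → ¬ Disjoint A B → N A = N B := by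
    intro A B hA hB hAB
    ext C
    simp only [N, Finset.mem_filter, Finset.mem_univ, true_and]
    constructor
    · rintro ⟨hC, hAC⟩
      exact ⟨hC, not_disjoint_of_common_clique (by omega) hdeg hA hB hC hAB hAC⟩
    · rintro ⟨hC, hBC⟩
      exact ⟨hC, not_disjoint_of_common_clique (by omega) hdeg hB hA hC
        (fun h => hAB h.symm) hBC⟩
  have hDmem : ∀ A, G.IsNClique w A → ∀ x, x ∈ D A ↔ ∀ B ∈ N A, x ∈ B := by
    intro A hA x
    simp only [D, Finset.mem_filter, and_iff_right_iff_imp]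
    exact fun h => h A (by simpa [N, hA] using hself A hA)
  have hDeq : ∀ A B, G.IsNClique w A → G.IsNClique w B → ¬ Disjoint A B → D A = D B := by
    intro A B hA hB hAB
    ext x
    rw [hDmem A hA, hDmem B hB, hNeq A B hA hB hAB]
  have hDF : ∀ A, G.IsNClique w A → ∀ x ∈ D A, ∀ y ∈ F A, y ≠ x → G.Adj x y := by
    intro A hA x hx y hy hyx
    rcases Finset.mem_union.1 hy with hy | hy
    · exact hA.1.adj_of_mem (hDA A hx) hy hyx.symm
    · obtain ⟨B, hB, hy⟩ := Finset.mem_biUnion.1 hy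
      have hB' : G.IsNClique w B ∧ ¬ Disjoint A B := by simpa [N] using hB
      exact hB'.1.1.adj_of_mem ((hDmem A hA x).1 hx B hB) hy hyx.symm
  let J : SimpleGraph V :=
    { Adj := fun x y => G.Adj x y ∧ ∃ A B, G.IsNClique w A ∧ G.IsNClique w B ∧ Disjoint A B ∧
        x ∈ D A ∧ y ∈ D B
      symm := ⟨fun x y ⟨h, A, B, hA, hB, hAB, hx, hy⟩ =>
        ⟨h.symm, B, A, hB, hA, hAB.symm, hy, hx⟩⟩
      loopless := ⟨fun x h => G.irrefl h.1⟩ }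
  -- outer neighbours of a kernel vertex
  have hJ : ∀ A, G.IsNClique w A → ∀ x ∈ D A, ∀ T : Finset V, (∀ y ∈ T, J.Adj x y) →
      T.card + (F A).card ≤ w + 2 := by
    intro A hA x hx T hT
    have hdis : Disjoint T (F A) := by
      rw [Finset.disjoint_left]
      intro y hyT hyF
      obtain ⟨-, A', B, hA', hB, hdis, hx', hy⟩ := hT y hyT
      have hAA' : ¬ Disjoint A' A :=
        Finset.not_disjoint_iff.2 ⟨x, hDA _ hx', hDA _ hx⟩
      obtain ⟨C, hC, hCA, hyC⟩ : ∃ C, G.IsNClique w C ∧ ¬ Disjoint A C ∧ y ∈ C := by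
        rcases Finset.mem_union.1 hyF with hyF | hyF
        · exact ⟨A, hA, hself A hA, hyF⟩
        · obtain ⟨C, hC, hyC⟩ := Finset.mem_biUnion.1 hyF
          have hC' : G.IsNClique w C ∧ ¬ Disjoint A C := by simpa [N] using hC
          exact ⟨C, hC'.1, hC'.2, hyC⟩
      have hCB : ¬ Disjoint C B := Finset.not_disjoint_iff.2 ⟨y, hyC, hDA _ hy⟩
      have hCA' : ¬ Disjoint C A' :=
        not_disjoint_of_common_clique (by omega) hdeg hA hC hA' hCA fun h => hAA' h.symm
      exact not_disjoint_of_common_clique (by omega) hdeg hC hA' hB hCA' hCB hdis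
    rw [← Finset.card_union_of_disjoint hdis]
    refine card_le_of_common_vertex hdeg (v := x) ?_
    intro y hy hyx
    rcases Finset.mem_union.1 hy with hy | hy
    · exact (hT y hy).1
    · exact hDF A hA x hx y hy hyx
  have hJdeg : ∀ v (T : Finset V), (∀ x ∈ T, J.Adj v x) → T.card ≤ 2 := by
    intro v T hT
    rcases T.eq_empty_or_nonempty with rfl | ⟨y, hy⟩
    · simp
    obtain ⟨-, A, B, hA, -, -, hv, -⟩ := hT y hy
    have h1 := hJ A hA v hv T hT
    have h2 : A.card ≤ (F A).card := Finset.card_le_card Finset.subset_union_left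
    have := hA.2
    omega
  let Q : Finset (Finset V) := (Finset.univ.filter fun A => G.IsNClique w A).image D
  have hQ : ∀ P ∈ Q, ∃ A, G.IsNClique w A ∧ D A = P := by
    intro P hP
    simpa [Q] using hP
  obtain ⟨t, htP, htJ⟩ := exists_independent_transversal J hJdeg
    (fun i : {P // P ∈ Q ∧ 8 ≤ P.card} => i.1) (fun i => i.2.2) (by
      rintro ⟨P, hP, hP8⟩ ⟨P', hP', hP8'⟩ hne
      obtain ⟨A, hA, rfl⟩ := hQ P hP
      obtain ⟨B, hB, rfl⟩ := hQ P' hP'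
      have hAB : Disjoint A B := by
        by_contra hcon
        exact hne (Subtype.ext (hDeq A B hA hB hcon))
      exact hAB.mono (hDA A) (hDA B))
  have hpick : ∀ P ∈ Q, ∃ x ∈ P, ∀ h : P ∈ Q ∧ 8 ≤ P.card, x = t ⟨P, h⟩ := by
    intro P hP
    by_cases h8 : 8 ≤ P.card
    · exact ⟨t ⟨P, hP, h8⟩, htP ⟨P, hP, h8⟩, fun _ => rfl⟩
    · obtain ⟨A, hA, rfl⟩ := hQ P hP
      have := (hHaj A hA).1
      obtain ⟨x, hx⟩ : (D A).Nonempty := Finset.card_pos.1 (by omega)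
      exact ⟨x, hx, fun h => absurd h.2 h8⟩
  choose! f hfP hft using hpick
  -- parts with fewer than eight vertices have no outer neighbours
  have hsmall : ∀ A, G.IsNClique w A → (D A).card < 8 → ∀ x ∈ D A, ∀ y, ¬ J.Adj x y := by
    intro A hA h8 x hx y hxy
    have h1 := hJ A hA x hx {y} (by simpa using hxy)
    have h2 := (hHaj A hA).2
    simp at h1
    omega
  refine ⟨Q.image f, ?_, ?_⟩
  · intro x hx y hy hxy
    obtain ⟨P, hP, rfl⟩ := Finset.mem_image.1 hx
    obtain ⟨P', hP', rfl⟩ := Finset.mem_image.1 hy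
    have hne : P ≠ P' := by
      rintro rfl
      exact G.irrefl hxy
    obtain ⟨A, hA, rfl⟩ := hQ P hP
    obtain ⟨B, hB, rfl⟩ := hQ P' hP'
    have hAB : Disjoint A B := by
      by_contra hcon
      exact hne (hDeq A B hA hB hcon)
    have hJxy : J.Adj (f (D A)) (f (D B)) :=
      ⟨hxy, A, B, hA, hB, hAB, hfP _ hP, hfP _ hP'⟩
    by_cases h8 : 8 ≤ (D A).card
    · by_cases h8' : 8 ≤ (D B).card
      · rw [hft _ hP ⟨hP, h8⟩, hft _ hP' ⟨hP', h8'⟩] at hJxy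
        exact htJ _ _ (fun h => hne (congrArg Subtype.val h)) hJxy
      · exact hsmall B hB (by omega) _ (hfP _ hP') _ hJxy.symm
    · exact hsmall A hA (by omega) _ (hfP _ hP) _ hJxy
  · intro A hA
    have hP : D A ∈ Q := by
      simp only [Q, Finset.mem_image, Finset.mem_filter, Finset.mem_univ, true_and]
      exact ⟨A, hA, rfl⟩
    exact ⟨f (D A), Finset.mem_image_of_mem _ hP, hDA A (hfP _ hP)⟩

theorem card_le_maxDeg {V : Type*} [Fintype V] (G : SimpleGraph V) (v : V) (T : Finset V)
    (hT : ∀ x ∈ T, G.Adj v x) : T.card ≤ maxDeg G := by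
  calc T.card = (T : Set V).ncard := (Set.ncard_coe_finset T).symm
    _ ≤ (G.neighborSet v).ncard := Set.ncard_le_ncard (fun x hx => hT x hx) (Set.toFinite _)
    _ ≤ maxDeg G := Finset.le_sup (f := fun v => (G.neighborSet v).ncard) (Finset.mem_univ v)

theorem maxDeg_le {V : Type*} [Fintype V] {G : SimpleGraph V} {k : ℕ}
    (h : ∀ v (T : Finset V), (∀ x ∈ T, G.Adj v x) → T.card ≤ k) : maxDeg G ≤ k := by
  classical
  refine Finset.sup_le fun v _ => ?_
  rw [Set.ncard_eq_toFinset_card' (G.neighborSet v)]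
  exact h v _ (by simp)

theorem colorable_of_maxDeg_le_of_cliqueNum_le {V : Type*} [Fintype V] (G : SimpleGraph V) {k : ℕ}
    (hk : 3 ≤ k) (hdeg : maxDeg G ≤ k) (hclique : G.cliqueNum ≤ k) : G.Colorable k := by
  obtain ⟨c, hc⟩ := exists_properOn_of_degree_le_of_clique_le G hk
    (fun v T hT => (card_le_maxDeg G v T hT).trans hdeg)
    (fun T hT => hT.card_le_cliqueNum.trans hclique) Finset.univ
  exact ⟨Coloring.mk c fun {x y} h => hc x (Finset.mem_univ _) y (Finset.mem_univ _) h⟩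

/-- Removing a suitable independent set decreases both the maximum degree and the clique
number. -/
theorem exists_isIndepSet_induce_compl {V : Type*} [Fintype V] (G : SimpleGraph V) {n : ℕ}
    (hn : 9 ≤ n) (hdeg : maxDeg G ≤ n + 1) (hclique : G.cliqueNum ≤ n) :
    ∃ s : Finset V, (∀ x ∉ s, ∀ y ∉ s, ¬ G.Adj x y) ∧
      maxDeg (G.induce (s : Set V)) ≤ n ∧ (G.induce (s : Set V)).cliqueNum ≤ n - 1 := by
  classical
  have hdeg' : ∀ v (T : Finset V), (∀ x ∈ T, G.Adj v x) → T.card ≤ n + 1 :=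
    fun v T hT => (card_le_maxDeg G v T hT).trans hdeg
  have hclique' : ∀ T : Finset V, G.IsClique (T : Set V) → T.card ≤ n :=
    fun T hT => hT.card_le_cliqueNum.trans hclique
  obtain ⟨I₀, hI₀, hmeet⟩ := exists_isIndepSet_inter_isNClique G hn hdeg' hclique'
  obtain ⟨I, hle, hI, hmax⟩ :=
    Finite.exists_le_maximal (p := fun I : Finset V => ∀ x ∈ I, ∀ y ∈ I, ¬ G.Adj x y) hI₀
  have hdom : ∀ v ∉ I, ∃ u ∈ I, G.Adj v u := by
    intro v hv
    by_contra! hcon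
    refine hv (hmax (y := insert v I) ?_ (Finset.subset_insert _ _) (Finset.mem_insert_self _ _))
    intro x hx y hy hxy
    rcases Finset.mem_insert.1 hx with rfl | hx' <;> rcases Finset.mem_insert.1 hy with rfl | hy'
    · exact G.irrefl hxy
    · exact hcon y hy' hxy
    · exact hcon x hx' hxy.symm
    · exact hI x hx' y hy' hxy
  refine ⟨Iᶜ, fun x hx y hy => hI x (by simpa using hx) y (by simpa using hy), ?_, ?_⟩
  · refine maxDeg_le fun v T hT => ?_
    obtain ⟨u, huI, hvu⟩ := hdom v.1 (by simpa using v.2)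
    have hu : u ∉ T.map (Function.Embedding.subtype _) := by
      intro h
      obtain ⟨z, -, rfl⟩ := Finset.mem_map.1 h
      have := z.2
      simp at this
      exact this huI
    have := hdeg' v.1 (insert u (T.map (Function.Embedding.subtype _))) (by
      intro x hx
      rcases Finset.mem_insert.1 hx with rfl | hx
      · exact hvu
      · obtain ⟨z, hz, rfl⟩ := Finset.mem_map.1 hx
        exact hT z hz)
    rw [Finset.card_insert_of_notMem hu, Finset.card_map] at this
    omega
  · obtain ⟨T, hT⟩ := (G.induce ((Iᶜ : Finset V) : Set V)).exists_isNClique_cliqueNum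
    set T' := T.map (Function.Embedding.subtype _) with hT'
    have hcl : G.IsClique (T' : Set V) := by
      intro x hx y hy hxy
      obtain ⟨x, hx', rfl⟩ := Finset.mem_map.1 (Finset.mem_coe.1 hx)
      obtain ⟨y, hy', rfl⟩ := Finset.mem_map.1 (Finset.mem_coe.1 hy)
      exact hT.1 (Finset.mem_coe.2 hx') (Finset.mem_coe.2 hy') fun h => hxy (h ▸ rfl)
    have hcard : T'.card = (G.induce ((Iᶜ : Finset V) : Set V)).cliqueNum := by
      rw [hT', Finset.card_map, hT.2]
    have hle' := hclique' T' hcl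
    have hne : T'.card ≠ n := by
      intro h
      obtain ⟨x, hx, hxT⟩ := hmeet T' ⟨hcl, h⟩
      obtain ⟨z, -, rfl⟩ := Finset.mem_map.1 hxT
      have := z.2
      simp at this
      exact this (hle hx)
    omega

theorem colorable_succ_of_induce {V : Type*} {G : SimpleGraph V} {s : Set V} {n : ℕ}
    (hs : ∀ x ∉ s, ∀ y ∉ s, ¬ G.Adj x y) (h : (G.induce s).Colorable n) :
    G.Colorable (n + 1) := by
  classical
  obtain ⟨c⟩ := h
  refine ⟨Coloring.mk (fun v => if hv : v ∈ s then (c ⟨v, hv⟩).castSucc else Fin.last n) ?_⟩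
  intro x y hxy
  by_cases hx : x ∈ s <;> by_cases hy : y ∈ s
  · simp only [hx, hy, dite_true, ne_eq, Fin.castSucc_inj]
    exact c.valid (v := ⟨x, hx⟩) (w := ⟨y, hy⟩) hxy
  · simp only [hx, hy, dite_true, dite_false]
    exact (Fin.castSucc_lt_last _).ne
  · simp only [hx, hy, dite_true, dite_false]
    exact (Fin.castSucc_lt_last _).ne'
  · exact absurd hxy (hs x hx y hy)

theorem stmt5 (𝒢 : ∀ (V : Type) [Fintype V], SimpleGraph V → Prop)
    (hered : ∀ (V : Type) [Fintype V] (G : SimpleGraph V), 𝒢 V G →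
      ∀ s : Finset V, 𝒢 ↥(s : Set V) (G.induce (s : Set V)))
    (hbase : ∀ (V : Type) [Fintype V] (G : SimpleGraph V), 𝒢 V G →
      maxDeg G = 9 → G.cliqueNum ≤ 8 → G.chromaticNumber ≤ (8 : ℕ∞)) :
    ∀ (V : Type) [Fintype V] (G : SimpleGraph V), 𝒢 V G →
      9 ≤ maxDeg G → G.cliqueNum ≤ maxDeg G - 1 →
      G.chromaticNumber ≤ ((maxDeg G - 1 : ℕ) : ℕ∞) := by
  suffices hmain : ∀ n, 9 ≤ n → ∀ (V : Type) [Fintype V] (G : SimpleGraph V), 𝒢 V G →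
      maxDeg G = n → G.cliqueNum ≤ n - 1 → G.Colorable (n - 1) from
    fun V _ G hG h9 hω => (hmain _ h9 V G hG rfl hω).chromaticNumber_le
  intro n hn
  induction n, hn using Nat.le_induction with
  | base =>
    intro V _ G hG hΔ hω
    exact chromaticNumber_le_iff_colorable.1 (hbase V G hG hΔ hω)
  | succ n hn ih =>
    intro V _ G hG hΔ hω
    obtain ⟨s, hs, hdeg, hclique⟩ := exists_isIndepSet_induce_compl G hn hΔ.le hω
    have hcol : (G.induce (s : Set V)).Colorable (n - 1) := by
      rcases hdeg.eq_or_lt with heq | hlt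
      · exact ih _ _ (hered V G hG s) heq hclique
      · exact colorable_of_maxDeg_le_of_cliqueNum_le _ (by omega) (by omega) hclique
    have := colorable_succ_of_induce (by simpa using hs) hcol
    rwa [Nat.sub_add_cancel (by omega)] at this
end

section
/- Every (P_5, gem)-free graph G with Δ(G) ≥ 9 and ω(G) ≤ Δ(G) - 1 satisfies χ(G) ≤ Δ(G) - 1. -/
open SimpleGraph

/-- The gem: the join `K₁ ∨ P₄`, with apex vertex `4` and path `0 - 1 - 2 - 3`. -/
def gem : SimpleGraph (Fin 5) :=
  fromEdgeSet {s(0, 1), s(1, 2), s(2, 3), s(0, 4), s(1, 4), s(2, 4), s(3, 4)}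

section NearColouring

variable {V : Type*} {G : SimpleGraph V} {k : ℕ} {c : V → ℕ} {u v w p q r s t x y : V} {b : ℕ}

/-- `G` is `(P₅, gem)`-free with maximum degree at most `k + 1` and no clique on `k + 1` vertices,
but is not `k`-colourable. -/
structure IsObstruction (G : SimpleGraph V) (k : ℕ) : Prop where
  p5 : ∀ a b c d e, G.Adj a b → G.Adj b c → G.Adj c d → G.Adj d e → ¬ G.Adj a c → ¬ G.Adj a d →
    ¬ G.Adj a e → ¬ G.Adj b d → ¬ G.Adj b e → ¬ G.Adj c e → False
  gem : ∀ a b c d z, G.Adj a b → G.Adj b c → G.Adj c d → ¬ G.Adj a c → ¬ G.Adj a d →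
    ¬ G.Adj b d → G.Adj z a → G.Adj z b → G.Adj z c → G.Adj z d → False
  deg : ∀ v (s : Finset V), (∀ w ∈ s, G.Adj v w) → s.card ≤ k + 1
  clique : ∀ s : Finset V, G.IsClique s → s.card ≤ k
  not_col : ¬ ∃ c : V → ℕ, (∀ x y, G.Adj x y → c x ≠ c y) ∧ ∀ x, c x < k

/-- `c` is a proper colouring with colours `0, …, k` in which only `v` has colour `k`, that is, a
proper `k`-colouring of `G - v`. -/
structure NearCol (G : SimpleGraph V) (k : ℕ) (v : V) (c : V → ℕ) : Prop where
  proper : ∀ {x y}, G.Adj x y → c x ≠ c y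
  self : c v = k
  lt : ∀ {x}, x ≠ v → c x < k

/-- `u` is the only neighbour of `v` with its colour. -/
def Uniq (G : SimpleGraph V) (c : V → ℕ) (v u : V) : Prop :=
  G.Adj v u ∧ ∀ w, G.Adj v w → c w = c u → w = u

/-- The colour `b` appears on two neighbours of `p`. -/
def Dbl (G : SimpleGraph V) (c : V → ℕ) (p : V) (b : ℕ) : Prop :=
  ∃ s t, s ≠ t ∧ G.Adj p s ∧ G.Adj p t ∧ c s = b ∧ c t = b

open Classical in
/-- Exchange the colours of `v` and `p`. -/
noncomputable def shift (c : V → ℕ) (v p : V) : V → ℕ :=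
  fun w => if w = p then c v else if w = v then c p else c w

theorem shift_of_ne (h₁ : w ≠ p) (h₂ : w ≠ v) : shift c v p w = c w := by simp [shift, h₁, h₂]

theorem shift_left (h : v ≠ p) : shift c v p v = c p := by simp [shift, h]

theorem shift_right : shift c v p p = c v := by simp [shift]

namespace NearCol

theorem ne_of_lt (h : NearCol G k v c) (hw : c w < k) : w ≠ v := by
  rintro rfl; exact hw.ne h.self

theorem ne_of_color (h : NearCol G k v c) (hp : p ≠ v) (hw : c w = c p) : w ≠ v :=
  h.ne_of_lt (hw ▸ h.lt hp)

theorem not_adj_of_eq (h : NearCol G k v c) (hc : c x = c y) : ¬ G.Adj x y :=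
  fun hxy => h.proper hxy hc

/-- Every colour appears in the neighbourhood of the uncoloured vertex. -/
theorem sees (hG : IsObstruction G k) (h : NearCol G k v c) (hb : b < k) :
    ∃ u, G.Adj v u ∧ c u = b := by
  classical
  by_contra! hno
  refine hG.not_col ⟨Function.update c v b, fun x y hxy => ?_, fun x => ?_⟩
  · have := hxy.ne
    have := h.proper hxy
    by_cases hx : x = v <;> by_cases hy : y = v
    · subst hx hy; simp at *
    · subst hx; simpa [hy] using (hno y hxy).symm
    · subst hy; simpa [hx] using hno x hxy.symm
    · simpa [hx, hy]
  · by_cases hx : x = v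
    · simpa [hx]
    · simpa [hx] using h.lt hx

theorem shift (h : NearCol G k v c) (hp : Uniq G c v p) : NearCol G k p (shift c v p) := by
  have hvp := hp.1.ne
  have hpk := h.lt hvp.symm
  have key : ∀ {x y}, G.Adj x y → y ≠ p → x = p → _root_.shift c v p x ≠ _root_.shift c v p y := by
    rintro x y hxy hy rfl
    rw [shift_right, h.self]
    by_cases hyv : y = v
    · subst hyv; rw [shift_left hvp]; exact hpk.ne'
    · rw [shift_of_ne hy hyv]; exact (h.lt hyv).ne'
  have key2 : ∀ {x y}, G.Adj x y → x ≠ p → y ≠ p → x = v →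
      _root_.shift c v p x ≠ _root_.shift c v p y := by
    rintro x y hxy hx hy rfl
    rw [shift_left hvp, shift_of_ne hy hxy.ne']
    exact fun he => hy (hp.2 y hxy he.symm)
  refine ⟨fun {x y} hxy => ?_, by rw [shift_right, h.self], fun {x} hx => ?_⟩
  · by_cases hx : x = p
    · exact key hxy (hx ▸ hxy.ne') hx
    by_cases hy : y = p
    · exact (key hxy.symm hx hy).symm
    by_cases hxv : x = v
    · exact key2 hxy hx hy hxv
    by_cases hyv : y = v
    · exact (key2 hxy.symm hy hx hyv).symm
    rw [shift_of_ne hx hxv, shift_of_ne hy hyv]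
    exact h.proper hxy
  · by_cases hxv : x = v
    · subst hxv; rwa [shift_left hvp]
    · rw [shift_of_ne hx hxv]; exact h.lt hxv

/-- After exchanging `v` and `p`, the vertex `v` is a uniquely coloured neighbour of `p`. -/
theorem uniq_shift_self (h : NearCol G k v c) (hp : Uniq G c v p) :
    Uniq G (_root_.shift c v p) p v := by
  have hvp := hp.1.ne
  refine ⟨hp.1.symm, fun w hw hc => ?_⟩
  by_contra hwv
  rw [shift_left hvp, shift_of_ne hw.ne' hwv] at hc
  exact h.proper hw hc.symm

/-- A colour below `k` other than that of `p` is unaffected by the exchange of `v` and `p`. -/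
theorem shift_eq_iff (h : NearCol G k v c) (hp : Uniq G c v p) (hb : b < k) (hbp : b ≠ c p) :
    _root_.shift c v p w = b ↔ c w = b := by
  have hvp := hp.1.ne
  by_cases hw : w = p
  · subst hw; rw [shift_right, h.self]; constructor
    · intro h'; omega
    · intro h'; exact absurd h'.symm hbp
  by_cases hwv : w = v
  · subst hwv; rw [shift_left hvp, h.self]; constructor
    · intro h'; exact absurd h'.symm hbp
    · intro h'; omega
  rw [shift_of_ne hw hwv]

theorem uniq_shift (h : NearCol G k v c) (hp : Uniq G c v p) (htv : t ≠ v) (hpt : G.Adj p t)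
    (ht : ¬ Dbl G c p (c t)) : Uniq G (_root_.shift c v p) p t := by
  refine ⟨hpt, fun w hw hc => ?_⟩
  rw [shift_of_ne hpt.ne' htv,
    h.shift_eq_iff hp (h.lt htv) (h.proper hpt).symm] at hc
  by_contra hwt
  exact ht ⟨w, t, hwt, hw, hpt, hc, rfl⟩

theorem dbl_shift (h : NearCol G k v c) (hp : Uniq G c v p) (hb : b < k) (hbp : b ≠ c p) :
    Dbl G (_root_.shift c v p) x b ↔ Dbl G c x b := by
  simp only [Dbl, h.shift_eq_iff hp hb hbp]

/-- The Kempe chain of a uniquely coloured neighbour of `v` is short in a `P₅`-free graph. -/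
theorem kempe (hG : IsObstruction G k) (h : NearCol G k v c) (hp : Uniq G c v p) (hb : b < k)
    (hbp : b ≠ c p) : ∃ q, G.Adj v q ∧ c q = b ∧ (G.Adj p q ∨
      ∃ x y, c x = b ∧ c y = c p ∧ G.Adj p x ∧ G.Adj x y ∧ G.Adj y q) := by
  classical
  by_contra! hno
  have hpk := h.lt hp.1.ne'
  let S : V → Prop := fun w => w = p ∨ (c w = b ∧ G.Adj p w) ∨
    (c w = c p ∧ ∃ x, c x = b ∧ G.Adj p x ∧ G.Adj x w) ∨
    (c w = b ∧ ∃ x y, c x = b ∧ c y = c p ∧ G.Adj p x ∧ G.Adj x y ∧ G.Adj y w)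
  have hS : ∀ w, S w → c w = b ∨ c w = c p := by
    rintro w (rfl | h1 | h1 | h1)
    exacts [.inr rfl, .inl h1.1, .inr h1.1, .inl h1.1]
  have hSv : ∀ w, S w → c w = b → ¬ G.Adj v w := by
    rintro w (rfl | h1 | h1 | ⟨h1, x, y, h2, h3, h4, h5, h6⟩) hw hvw
    · exact hbp hw.symm
    · exact (hno w hvw hw).1 h1.2
    · exact hbp (hw ▸ h1.1)
    · exact (hno w hvw hw).2 x y h2 h3 h4 h5 h6
  have hcl : ∀ w u, S w → G.Adj w u →
      (c w = b → c u = c p → S u) ∧ (c w = c p → c u = b → S u) := by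
    rintro w u (rfl | h1 | ⟨h1, x, h2, h3, h4⟩ | ⟨h1, x, y, h2, h3, h4, h5, h6⟩) hwu
    · exact ⟨fun h' => absurd h'.symm hbp, fun _ h' => .inr (.inl ⟨h', hwu⟩)⟩
    · exact ⟨fun _ h' => .inr (.inr (.inl ⟨h', w, h1.1, h1.2, hwu⟩)),
        fun h' => absurd (h1.1.symm.trans h') hbp⟩
    · exact ⟨fun h' => absurd (h'.symm.trans h1) hbp,
        fun _ h' => .inr (.inr (.inr ⟨h', x, w, h2, h1, h3, h4, hwu⟩))⟩
    · refine ⟨fun _ h' => ?_, fun h' => absurd (h1.symm.trans h') hbp⟩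
      by_cases hpw : G.Adj p w
      · exact .inr (.inr (.inl ⟨h', w, h1, hpw, hwu⟩))
      by_cases hxu : G.Adj x u
      · exact .inr (.inr (.inl ⟨h', x, h2, h4, hxu⟩))
      exact (hG.p5 p x y w u h4 h5 h6 hwu (h.not_adj_of_eq h3.symm) hpw
        (h.not_adj_of_eq h'.symm) (h.not_adj_of_eq (h2.trans h1.symm)) hxu
        (h.not_adj_of_eq (h3.trans h'.symm))).elim
  let c' : V → ℕ := fun w => if w = v then c p else
    if S w then (if c w = b then c p else b) else c w
  have hSp : S p := .inl rfl
  have key : ∀ w, G.Adj v w → c' w ≠ c p := by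
    intro w hw
    simp only [c', hw.ne', if_false]
    split_ifs with h1 h2
    · exact (hSv w h1 h2 hw).elim
    · exact hbp
    · intro h3; exact h1 (hp.2 w hw h3 ▸ hSp)
  refine hG.not_col ⟨c', fun x y hxy => ?_, fun x => ?_⟩
  · by_cases hx : x = v
    · subst hx
      have : c' x = c p := by simp [c']
      rw [this]; exact (key y hxy).symm
    by_cases hy : y = v
    · subst hy
      have : c' y = c p := by simp [c']
      rw [this]; exact key x hxy.symm
    have h1 := hcl x y
    have h2 := hcl y x
    have h3 := hS x
    have h4 := hS y
    have h5 := h.proper hxy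
    have h6 := hxy.symm
    simp only [c', hx, hy, if_false]
    grind
  · have h1 := hS x
    by_cases hx : x = v
    · simpa [c', hx] using hpk
    · have := h.lt hx
      simp only [c', hx, if_false]
      split_ifs <;> assumption

/-- At most one pair of neighbours of the uncoloured vertex shares a colour. -/
theorem excess [Fintype V] (hG : IsObstruction G k) (h : NearCol G k v c) {s' t' : V}
    (hs : G.Adj v s) (ht : G.Adj v t) (hst : s ≠ t) (hc : c s = c t)
    (hs' : G.Adj v s') (ht' : G.Adj v t') (hst' : s' ≠ t') (hc' : c s' = c t') :
    s' = s ∨ s' = t := by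
  classical
  by_contra! hne
  let N : Finset V := Finset.univ.filter (G.Adj v)
  have hN : N.card ≤ k + 1 := hG.deg v N (by simp [N])
  have hsub : Finset.range k ⊆ ((N.erase s).erase s').image c := by
    intro b hb
    obtain ⟨u, hu, rfl⟩ := h.sees hG (Finset.mem_range.1 hb)
    simp only [Finset.mem_image, Finset.mem_erase, N, Finset.mem_filter, Finset.mem_univ, true_and]
    grind
  have h1 := (Finset.card_le_card hsub).trans Finset.card_image_le
  rw [Finset.card_range, Finset.card_erase_of_mem (by simp [N, hne, hs']),
    Finset.card_erase_of_mem (by simp [N, hs])] at h1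
  have : 0 < N.card := Finset.card_pos.2 ⟨s, by simp [N, hs]⟩
  have : 1 < N.card := Finset.one_lt_card.2 ⟨s, by simp [N, hs], t, by simp [N, ht], hst⟩
  omega

theorem dbl_unique_self [Fintype V] (hG : IsObstruction G k) (h : NearCol G k v c) {b' : ℕ}
    (hb : Dbl G c v b) (hb' : Dbl G c v b') : b = b' := by
  obtain ⟨s, t, hst, hs, ht, rfl, hc⟩ := hb
  obtain ⟨s', t', hst', hs', ht', rfl, hc'⟩ := hb'
  rcases h.excess hG hs ht hst hc.symm hs' ht' hst' hc'.symm with rfl | rfl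
  exacts [rfl, hc.symm]

/-- A uniquely coloured neighbour of `v` has at most one repeated colour around it. -/
theorem dbl_unique [Fintype V] (hG : IsObstruction G k) (h : NearCol G k v c) (hp : Uniq G c v p)
    {b' : ℕ} (hb : Dbl G c p b) (hb' : Dbl G c p b') : b = b' := by
  have key : ∀ {b}, Dbl G c p b → b < k ∧ b ≠ c p := by
    rintro b ⟨s, t, hst, hs, ht, rfl, hc⟩
    refine ⟨?_, (h.proper hs).symm⟩
    by_cases hsv : s = v
    · subst hsv; exact hc ▸ h.lt hst.symm
    · exact h.lt hsv
  exact (h.shift hp).dbl_unique_self hG ((h.dbl_shift hp (key hb).1 (key hb).2).2 hb)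
    ((h.dbl_shift hp (key hb').1 (key hb').2).2 hb')

open Classical in
theorem card_uniq [Fintype V] (hG : IsObstruction G k) (h : NearCol G k v c) :
    k ≤ (Finset.univ.filter (Uniq G c v)).card + 1 ∧
    ((∀ u, G.Adj v u → Uniq G c v u) → k ≤ (Finset.univ.filter (Uniq G c v)).card) := by
  set U := Finset.univ.filter (Uniq G c v)
  have key : ∀ D : Finset ℕ, (∀ u, G.Adj v u → c u ∉ D → Uniq G c v u) →
      k ≤ U.card + D.card := by
    intro D hD
    have hsub : Finset.range k ⊆ U.image c ∪ D := by
      intro b hb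
      obtain ⟨u, hu, rfl⟩ := h.sees hG (Finset.mem_range.1 hb)
      by_cases hd : c u ∈ D
      · exact Finset.mem_union_right _ hd
      · exact Finset.mem_union_left _ (Finset.mem_image_of_mem _ (by simpa [U] using hD u hu hd))
    have h1 := (Finset.card_le_card hsub).trans (Finset.card_union_le _ _)
    rw [Finset.card_range] at h1
    exact h1.trans (Nat.add_le_add_right Finset.card_image_le _)
  refine ⟨?_, fun hall => by simpa using key ∅ fun u hu _ => hall u hu⟩
  by_cases hD : ∃ b, Dbl G c v b
  · obtain ⟨b, hb⟩ := hD
    refine key {b} fun u hu hc => ⟨hu, fun w hw hwu => ?_⟩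
    by_contra hne
    exact hc (Finset.mem_singleton.2 (h.dbl_unique_self hG ⟨w, u, hne, hw, hu, hwu, rfl⟩ hb))
  · have := key ∅ fun u hu _ => ⟨hu, fun w hw hwu => by
      by_contra hne
      exact hD ⟨_, w, u, hne, hw, hu, hwu, rfl⟩⟩
    simp at this
    omega

/-- Two nonadjacent uniquely coloured neighbours `p`, `q` of `v` lie on a five-cycle through `v`
whose remaining vertices `x`, `y` have the colours of `q` and `p`. -/
theorem exists_cycle (hG : IsObstruction G k) (h : NearCol G k v c) (hp : Uniq G c v p)
    (hq : Uniq G c v q) (hne : p ≠ q) (hpq : ¬ G.Adj p q) :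
    ∃ x y, c x = c q ∧ c y = c p ∧ G.Adj p x ∧ G.Adj x y ∧ G.Adj y q := by
  obtain ⟨q', h1, h2, h3⟩ := h.kempe hG hp (h.lt hq.1.ne')
    fun h' => hne (hq.2 p hp.1 h'.symm)
  obtain rfl := hq.2 q' h1 h2
  exact h3.resolve_left hpq

theorem not_adj_self (hq : Uniq G c v q) (hpq : ¬ G.Adj p q) (hx : c x = c q) (hpx : G.Adj p x) :
    ¬ G.Adj v x := by
  intro hvx
  exact hpq (hq.2 x hvx hx ▸ hpx)

/-- In the situation of `exists_cycle`, all candidates for `x` and `y` are adjacent. -/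
theorem adj_of_color (hG : IsObstruction G k) (h : NearCol G k v c) (hp : Uniq G c v p)
    (hq : Uniq G c v q) (hpq : ¬ G.Adj p q) (hx : c x = c q) (hpx : G.Adj p x)
    (hy : c y = c p) (hqy : G.Adj q y) : G.Adj x y := by
  by_contra hxy
  exact hG.p5 x p v q y hpx.symm hp.1.symm hq.1 hqy (fun h' => not_adj_self hq hpq hx hpx h'.symm)
    (h.not_adj_of_eq hx) hxy hpq (h.not_adj_of_eq hy.symm)
    (not_adj_self hp (fun h' => hpq h'.symm) hy hqy)

/-- A common neighbour of `v`, `p`, `q` is not adjacent to `x`. -/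
theorem common_not_adj (hG : IsObstruction G k) (h : NearCol G k v c) (hp : Uniq G c v p)
    (hq : Uniq G c v q) (hpq : ¬ G.Adj p q) (hx : c x = c q) (hpx : G.Adj p x)
    (hvt : G.Adj v t) (htp : G.Adj t p) (htq : G.Adj t q) : ¬ G.Adj t x := by
  intro htx
  exact hG.gem q v p x t hq.1.symm hp.1 hpx (fun h' => hpq h'.symm) (h.not_adj_of_eq hx.symm)
    (not_adj_self hq hpq hx hpx) htq hvt.symm htp htx

/-- If `t` is a uniquely coloured common neighbour of `p` and `q` whose colour is not repeated
around `p`, then `q` has a neighbour with the colour of `t` that is adjacent neither to `v` nor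
to `p`. -/
theorem exists_color_common (hG : IsObstruction G k) (h : NearCol G k v c) (hp : Uniq G c v p)
    (hq : Uniq G c v q) (ht : Uniq G c v t) (hne : p ≠ q) (hpq : ¬ G.Adj p q) (htp : G.Adj t p)
    (htq : G.Adj t q) (hd : ¬ Dbl G c p (c t)) :
    ∃ z, c z = c t ∧ G.Adj q z ∧ ¬ G.Adj v z ∧ ¬ G.Adj p z := by
  have hpv := hp.1.ne'
  have hqk := h.lt hq.1.ne'
  have hqp : c q ≠ c p := fun h' => hne (hp.2 q hq.1 h').symm
  obtain ⟨x₀, y, hx₀, hy, hpx₀, hxy₀, hyq⟩ := h.exists_cycle hG hp hq hne hpq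
  have htu := h.uniq_shift hp ht.1.ne' htp.symm hd
  have htc : _root_.shift c v p t = c t := shift_of_ne htp.ne ht.1.ne'
  obtain ⟨x, hpx, hx, h1⟩ := (h.shift hp).kempe hG htu (b := c q) hqk
    (by rw [htc]; exact (h.proper htq).symm)
  rw [h.shift_eq_iff hp hqk hqp] at hx
  have htx := h.common_not_adj hG hp hq hpq hx hpx ht.1 htp htq
  obtain ⟨w, z, hw, hz, htw, hwz, hzx⟩ := h1.resolve_left htx
  rw [h.shift_eq_iff hp hqk hqp] at hw
  rw [htc, h.shift_eq_iff hp (h.lt ht.1.ne') (h.proper htp)] at hz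
  have hpw : ¬ G.Adj p w := fun h' => h.common_not_adj hG hp hq hpq hw h' ht.1 htp htq htw
  have hwq : w = q := by
    by_contra hwq
    have hvw : ¬ G.Adj v w := fun h' => hwq (hq.2 w h' hw)
    have hvy := not_adj_self hp (fun h' => hpq h'.symm) hy hyq.symm
    have hty := h.common_not_adj hG hq hp (fun h' => hpq h'.symm) hy hyq.symm ht.1 htq htp
    have hxy := h.adj_of_color hG hp hq hpq hx hpx hy hyq.symm
    by_cases hwy : G.Adj w y
    · exact hG.p5 w y q v p hwy hyq hq.1.symm hp.1 (h.not_adj_of_eq hw)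
        (fun h' => hvw h'.symm) (fun h' => hpw h'.symm) (fun h' => hvy h'.symm)
        (h.not_adj_of_eq hy) (fun h' => hpq h'.symm)
    · exact hG.p5 w t p x y htw.symm htp hpx hxy (fun h' => hpw h'.symm)
        (h.not_adj_of_eq (hw.trans hx.symm)) hwy htx hty (h.not_adj_of_eq hy.symm)
  subst hwq
  refine ⟨z, hz, hwz, fun hvz => htx (ht.2 z hvz hz ▸ hzx), fun hpz => ?_⟩
  refine hd ⟨z, t, ?_, hpz, htp.symm, hz, rfl⟩
  rintro rfl
  exact htx hzx

/-- The colour of a common neighbour of two nonadjacent uniquely coloured neighbours of `v` is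
repeated around one of the two. -/
theorem dbl_of_common (hG : IsObstruction G k) (h : NearCol G k v c) (hp : Uniq G c v p)
    (hq : Uniq G c v q) (ht : Uniq G c v t) (hne : p ≠ q) (hpq : ¬ G.Adj p q) (htp : G.Adj t p)
    (htq : G.Adj t q) : Dbl G c p (c t) ∨ Dbl G c q (c t) := by
  by_contra! hd
  have hqp : ¬ G.Adj q p := fun h' => hpq h'.symm
  obtain ⟨z, hz, hqz, hvz, hpz⟩ := h.exists_color_common hG hp hq ht hne hpq htp htq hd.1
  obtain ⟨z', hz', hpz', hvz', hqz'⟩ :=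
    h.exists_color_common hG hq hp ht hne.symm hqp htq htp hd.2
  exact hG.p5 z q v p z' hqz.symm hq.1.symm hp.1 hpz' (fun h' => hvz h'.symm)
    (fun h' => hpz h'.symm) (h.not_adj_of_eq (hz.trans hz'.symm)) hqp hqz' hvz'

/-- For adjacent `p`, `t` nonadjacent to `q`, a neighbour of `p` with the colour of `q` that is not
adjacent to `t` makes the colour of `t` repeated around `p`, and that of `p` around `t`. -/
theorem dbl_of_not_adj (hG : IsObstruction G k) (h : NearCol G k v c) (hp : Uniq G c v p)
    (hq : Uniq G c v q) (ht : Uniq G c v t) (hpq : p ≠ q) (htq : t ≠ q) (hnpq : ¬ G.Adj p q)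
    (hntq : ¬ G.Adj t q) (hpt : G.Adj p t) (hx : c x = c q) (hpx : G.Adj p x)
    (htx : ¬ G.Adj t x) : Dbl G c p (c t) ∧ Dbl G c t (c p) := by
  have key : ∀ {p t x : V}, Uniq G c v p → Uniq G c v t → ¬ G.Adj p q → ¬ G.Adj t q →
      G.Adj p t → c x = c q → G.Adj p x → ¬ G.Adj t x → ∀ {y}, c y = c p → G.Adj q y →
      G.Adj t y := by
    intro p t x hp ht hnpq hntq hpt hx hpx htx y hy hqy
    by_contra hty
    exact hG.p5 t p x y q hpt.symm hpx (h.adj_of_color hG hp hq hnpq hx hpx hy hqy) hqy.symm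
      htx hty hntq (h.not_adj_of_eq hy.symm) hnpq (h.not_adj_of_eq hx)
  obtain ⟨x₀, y, -, hy, -, -, hyq⟩ := h.exists_cycle hG hp hq hpq hnpq
  obtain ⟨x', y', hx', hy', htx', hxy', hyq'⟩ := h.exists_cycle hG ht hq htq hntq
  have hty := key hp ht hnpq hntq hpt hx hpx htx hy hyq.symm
  have hpx' : ¬ G.Adj p x' := fun hpx' =>
    hG.gem v p x' y t hp.1 hpx' (h.adj_of_color hG hp hq hnpq hx' hpx' hy hyq.symm)
      (not_adj_self hq hnpq hx' hpx') (not_adj_self hp (fun h' => hnpq h'.symm) hy hyq.symm)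
      (h.not_adj_of_eq hy.symm) ht.1.symm hpt.symm htx' hty
  have hpy' := key ht hp hntq hnpq hpt.symm hx' htx' hpx' hy' hyq'.symm
  refine ⟨⟨y', t, ?_, hpy', hpt, hy', rfl⟩, ⟨y, p, ?_, hty, hpt.symm, hy, rfl⟩⟩
  · rintro rfl; exact hntq hyq'
  · rintro rfl; exact hnpq hyq

/-- If the colour of `q` is not repeated around `p`, then at most one uniquely coloured neighbour
of `v` that is adjacent to `p` but not to `q` has a colour that is not repeated around `p`. -/
theorem eq_of_not_dbl [Fintype V] (hG : IsObstruction G k) (h : NearCol G k v c)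
    (hp : Uniq G c v p) (hq : Uniq G c v q) (hpq : p ≠ q) (hnpq : ¬ G.Adj p q)
    (hd : ¬ Dbl G c p (c q)) (hs : Uniq G c v s) (ht : Uniq G c v t) (hps : G.Adj p s)
    (hpt : G.Adj p t) (hsq : ¬ G.Adj s q) (htq : ¬ G.Adj t q) (hds : ¬ Dbl G c p (c s))
    (hdt : ¬ Dbl G c p (c t)) : s = t := by
  obtain ⟨x, y, hx, hy, hpx, hxy, hyq⟩ := h.exists_cycle hG hp hq hpq hnpq
  have hvx := not_adj_self hq hnpq hx hpx
  have hxv : x ≠ v := h.ne_of_color hq.1.ne' hx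
  have hxu := h.uniq_shift hp hxv hpx (hx ▸ hd)
  have key : ∀ {t}, Uniq G c v t → G.Adj p t → ¬ G.Adj t q → ¬ Dbl G c p (c t) →
      Dbl G (_root_.shift c v p) x (c t) := by
    intro t ht hpt htq hdt
    have htq' : t ≠ q := by rintro rfl; exact hnpq hpt
    have htx : G.Adj t x := by
      by_contra htx
      exact hdt (h.dbl_of_not_adj hG hp hq ht hpq htq' hnpq htq hpt hx hpx htx).1
    have h1 := (h.shift hp).dbl_of_common hG (h.uniq_shift_self hp) hxu
      (h.uniq_shift hp ht.1.ne' hpt hdt) hxv.symm hvx ht.1.symm htx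
    rw [shift_of_ne hpt.ne' ht.1.ne'] at h1
    refine h1.resolve_left fun h2 => ?_
    rw [h.dbl_shift hp (h.lt ht.1.ne') (h.proper hpt).symm] at h2
    obtain ⟨s₁, s₂, hne, h3, h4, h5, h6⟩ := h2
    exact hne ((ht.2 _ h3 h5).trans (ht.2 _ h4 h6).symm)
  have := (h.shift hp).dbl_unique hG hxu (key hs hps hsq hds) (key ht hpt htq hdt)
  exact ht.2 s hs.1 this

/-- A clique of uniquely coloured neighbours of `v` that avoid `q`, around each of which the colour
of `q` is repeated, has at most `(k + 1) / 2` elements. -/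
theorem card_le_of_dbl [Fintype V] (hG : IsObstruction G k) (h : NearCol G k v c)
    (hq : Uniq G c v q) (P : Finset V) (hP : ∀ p ∈ P, Uniq G c v p ∧ p ≠ q ∧ ¬ G.Adj p q ∧
      Dbl G c p (c q)) (hcl : ∀ p ∈ P, ∀ t ∈ P, p ≠ t → G.Adj p t) : 2 * P.card ≤ k + 1 := by
  classical
  obtain rfl | ⟨p, hp⟩ := P.eq_empty_or_nonempty
  · simp
  obtain ⟨hpu, hpq, hnpq, hpd⟩ := hP p hp
  obtain ⟨x, -, hx, -, hpx, -, -⟩ := h.exists_cycle hG hpu hq hpq hnpq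
  have hxt : ∀ t ∈ P, G.Adj t x := by
    intro t ht
    by_cases htp : t = p
    · exact htp ▸ hpx
    obtain ⟨htu, htq, hntq, htd⟩ := hP t ht
    by_contra htx
    have h1 := (h.dbl_of_not_adj hG hpu hq htu hpq htq hnpq hntq
      (hcl p hp t ht (Ne.symm htp)) hx hpx htx).2
    exact hpq (hq.2 p hpu.1 (h.dbl_unique hG htu h1 htd))
  have hy : ∀ t ∈ P, ∃ y, c y = c t ∧ G.Adj x y ∧ G.Adj y q := by
    intro t ht
    obtain ⟨htu, htq, hntq, htd⟩ := hP t ht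
    obtain ⟨-, y, -, hy, -, -, hyq⟩ := h.exists_cycle hG htu hq htq hntq
    exact ⟨y, hy, h.adj_of_color hG htu hq hntq hx (hxt t ht) hy hyq.symm, hyq⟩
  choose! f hf using hy
  have hdisj : Disjoint P (P.image f) := by
    rw [Finset.disjoint_right]
    intro y hy hyP
    obtain ⟨t, ht, rfl⟩ := Finset.mem_image.1 hy
    exact (hP _ hyP).2.2.1 (hf t ht).2.2
  have hinj : Set.InjOn f P := by
    intro s hs t ht hst
    refine (hP t ht).1.2 s (hP s hs).1.1 ?_
    rw [← (hf s hs).1, ← (hf t ht).1, hst]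
  have := hG.deg x (P ∪ P.image f) (by
    intro w hw
    rcases Finset.mem_union.1 hw with hw | hw
    · exact (hxt w hw).symm
    · obtain ⟨t, ht, rfl⟩ := Finset.mem_image.1 hw
      exact (hf t ht).2.1)
  rw [Finset.card_union_of_disjoint hdisj, Finset.card_image_of_injOn hinj] at this
  omega

/-- No three uniquely coloured neighbours of `v` are pairwise nonadjacent. -/
theorem not_independent_triple (hG : IsObstruction G k) (h : NearCol G k v c) (hp : Uniq G c v p)
    (hq : Uniq G c v q) (hr : Uniq G c v r) (hpq : p ≠ q) (hpr : p ≠ r) (hqr : q ≠ r)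
    (hnpq : ¬ G.Adj p q) (hnpr : ¬ G.Adj p r) (hnqr : ¬ G.Adj q r) : False := by
  have aux : ∀ {p q r x y : V}, Uniq G c v p → Uniq G c v q → Uniq G c v r → p ≠ q → p ≠ r →
      ¬ G.Adj p q → ¬ G.Adj p r → ¬ G.Adj q r → c x = c q → G.Adj p x → G.Adj r x →
      c y = c r → G.Adj p y → G.Adj q y → False := by
    intro p q r x y hp hq hr hpq hpr hnpq hnpr hnqr hx hpx hrx hy hpy hqy
    obtain ⟨-, z, -, hz, -, -, hzq⟩ := h.exists_cycle hG hp hq hpq hnpq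
    obtain ⟨-, z', -, hz', -, -, hzr'⟩ := h.exists_cycle hG hp hr hpr hnpr
    have hxy := h.adj_of_color hG hr hq (fun h' => hnqr h'.symm) hx hrx hy hqy
    have no_common : ∀ z, c z = c p → G.Adj q z → ¬ G.Adj r z := fun z hz hqz hrz =>
      hG.gem p y z r x hpy (h.adj_of_color hG hp hr hnpr hy hpy hz hrz) hrz.symm
        (h.not_adj_of_eq hz.symm) hnpr (h.not_adj_of_eq hy) hpx.symm hxy
        (h.adj_of_color hG hp hq hnpq hx hpx hz hqz) hrx.symm
    exact hG.p5 z' r v q z hzr' hr.1.symm hq.1 hzq.symm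
      (fun h' => not_adj_self hp (fun h' => hnpr h'.symm) hz' hzr'.symm h'.symm)
      (fun h' => no_common z' hz' h'.symm hzr'.symm) (h.not_adj_of_eq (hz'.trans hz.symm))
      (fun h' => hnqr h'.symm) (no_common z hz hzq.symm)
      (not_adj_self hp (fun h' => hnpq h'.symm) hz hzq.symm)
  have share : ∀ {p q r : V}, Uniq G c v p → Uniq G c v q → Uniq G c v r → p ≠ q →
      ¬ G.Adj p q → ¬ G.Adj p r → ¬ G.Adj q r →
      (∃ x, c x = c q ∧ G.Adj p x ∧ G.Adj r x) ∨ ∃ y, c y = c p ∧ G.Adj q y ∧ G.Adj r y := by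
    intro p q r hp hq hr hpq hnpq hnpr hnqr
    obtain ⟨x, y, hx, hy, hpx, hxy, hyq⟩ := h.exists_cycle hG hp hq hpq hnpq
    by_contra! hno
    exact hG.p5 r v p x y hr.1.symm hp.1 hpx hxy (fun h' => hnpr h'.symm) (hno.1 x hx hpx)
      (hno.2 y hy hyq.symm) (not_adj_self hq hnpq hx hpx)
      (not_adj_self hp (fun h' => hnpq h'.symm) hy hyq.symm) (h.not_adj_of_eq hy.symm)
  have hnqp : ¬ G.Adj q p := fun h' => hnpq h'.symm
  have hnrp : ¬ G.Adj r p := fun h' => hnpr h'.symm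
  have hnrq : ¬ G.Adj r q := fun h' => hnqr h'.symm
  have h1 := share hp hq hr hpq hnpq hnpr hnqr
  have h2 := share hp hr hq hpr hnpr hnpq hnrq
  have h3 := share hq hr hp hqr hnqr hnqp hnrp
  have hpq' : (∃ x, c x = c q ∧ G.Adj p x ∧ G.Adj r x) →
      ¬ ∃ x, c x = c p ∧ G.Adj q x ∧ G.Adj r x := by
    rintro ⟨x, hx, hpx, hrx⟩ ⟨y, hy, hqy, hry⟩
    exact aux hr hq hp hqr.symm hpr.symm hnrq hnrp hnqp hx hrx hpx hy hry hqy
  have hpr' : (∃ x, c x = c r ∧ G.Adj p x ∧ G.Adj q x) →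
      ¬ ∃ x, c x = c p ∧ G.Adj q x ∧ G.Adj r x := by
    rintro ⟨x, hx, hpx, hqx⟩ ⟨y, hy, hqy, hry⟩
    exact aux hq hr hp hqr hpq.symm hnqr hnqp hnrp hx hqx hpx hy hqy hry
  have hqr' : (∃ x, c x = c q ∧ G.Adj p x ∧ G.Adj r x) →
      ¬ ∃ x, c x = c r ∧ G.Adj p x ∧ G.Adj q x := by
    rintro ⟨x, hx, hpx, hrx⟩ ⟨y, hy, hpy, hqy⟩
    exact aux hp hq hr hpq hpr hnpq hnpr hnqr hx hpx hrx hy hpy hqy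
  rcases h1 with ⟨x, hx, hpx, hrx⟩ | ⟨x, hx, hqx, hrx⟩
  · rcases h2 with ⟨y, hy, hpy, hqy⟩ | ⟨y, hy, hry, hqy⟩
    · exact hqr' ⟨x, hx, hpx, hrx⟩ ⟨y, hy, hpy, hqy⟩
    · exact hpq' ⟨x, hx, hpx, hrx⟩ ⟨y, hy, hqy, hry⟩
  · rcases h3 with ⟨y, hy, hqy, hpy⟩ | ⟨y, hy, hry, hpy⟩
    · exact hpr' ⟨y, hy, hpy, hqy⟩ ⟨x, hx, hqx, hrx⟩
    · exact hpq' ⟨y, hy, hpy, hry⟩ ⟨x, hx, hqx, hrx⟩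

/-- Among the uniquely coloured neighbours of `v`, those nonadjacent to `q` form a clique. -/
theorem adj_of_not_adj (hG : IsObstruction G k) (h : NearCol G k v c) (hq : Uniq G c v q)
    (hs : Uniq G c v s) (ht : Uniq G c v t) (hsq : s ≠ q) (htq : t ≠ q) (hnsq : ¬ G.Adj s q)
    (hntq : ¬ G.Adj t q) (hst : s ≠ t) : G.Adj s t :=
  by_contra fun hnst => h.not_independent_triple hG hs ht hq hst hsq htq hnst hnsq hntq

/-- For nonadjacent `p`, `q`, a uniquely coloured neighbour of `v` nonadjacent to `q` and one
nonadjacent to `p` are distinct and nonadjacent. -/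
theorem not_adj_of_not_adj (hG : IsObstruction G k) (h : NearCol G k v c) (hp : Uniq G c v p)
    (hq : Uniq G c v q) (hs : Uniq G c v s) (ht : Uniq G c v t) (hpq : p ≠ q)
    (hnpq : ¬ G.Adj p q) (hsq : s ≠ q) (htp : t ≠ p) (hnsq : ¬ G.Adj s q) (hntp : ¬ G.Adj t p) :
    s ≠ t ∧ ¬ G.Adj s t := by
  have hnpt : ¬ G.Adj p t := fun h' => hntp h'.symm
  refine ⟨?_, fun hst => ?_⟩
  · rintro rfl
    exact h.not_independent_triple hG hs hp hq htp hsq hpq hntp hnsq hnpq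
  · by_cases hsp : s = p
    · exact hnpt (hsp ▸ hst)
    by_cases htq : t = q
    · exact hnsq (htq ▸ hst)
    exact hG.gem p s t q v (h.adj_of_not_adj hG hq hp hs hpq hsq hnpq hnsq (Ne.symm hsp)) hst
      (h.adj_of_not_adj hG hp ht hq htp hpq.symm hntp (fun h' => hnpq h'.symm) htq)
      hnpt hnpq hnsq hp.1 hs.1 ht.1 hq.1

/-- Uniquely coloured neighbours of `v` adjacent to both `p` and `q` are adjacent to those that are
nonadjacent to `q`. -/
theorem adj_of_adj_adj (hG : IsObstruction G k) (h : NearCol G k v c) (hp : Uniq G c v p)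
    (hq : Uniq G c v q) (hr : Uniq G c v r) (hs : Uniq G c v s) (hpq : p ≠ q)
    (hnpq : ¬ G.Adj p q) (hrp : G.Adj r p) (hrq : G.Adj r q) (hsq : s ≠ q)
    (hnsq : ¬ G.Adj s q) : G.Adj r s := by
  by_cases hsp : s = p
  · exact hsp ▸ hrp
  by_contra hrs
  exact hG.gem s p r q v (h.adj_of_not_adj hG hq hs hp hsq hpq hnsq hnpq hsp) hrp.symm hrq
    (fun h' => hrs h'.symm) hnsq hnpq hs.1 hp.1 hr.1 hq.1

open Classical in
theorem card_dbl_le_one [Fintype V] (hG : IsObstruction G k) (h : NearCol G k v c)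
    (hp : Uniq G c v p) :
    ((Finset.univ.filter (Uniq G c v)).filter fun t => Dbl G c p (c t)).card ≤ 1 := by
  rw [Finset.card_le_one]
  simp only [Finset.mem_filter, Finset.mem_univ, true_and]
  rintro s ⟨hs, hsd⟩ t ⟨ht, htd⟩
  exact ht.2 s hs.1 (h.dbl_unique hG hp hsd htd)

theorem exists_not_dbl [Fintype V] (hG : IsObstruction G k) (hk : 8 ≤ k) (h : NearCol G k v c)
    (hp : Uniq G c v p) (hq : Uniq G c v q) (hpq : p ≠ q) (hnpq : ¬ G.Adj p q) :
    ∃ s t, Uniq G c v s ∧ Uniq G c v t ∧ s ≠ q ∧ t ≠ p ∧ ¬ G.Adj s q ∧ ¬ G.Adj t p ∧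
      ¬ Dbl G c s (c t) := by
  classical
  by_contra! hno
  have hnqp : ¬ G.Adj q p := fun h' => hnpq h'.symm
  set U := Finset.univ.filter (Uniq G c v)
  let P := U.filter fun t => t ≠ q ∧ ¬ G.Adj t q
  have hP : 2 * P.card ≤ k + 1 := by
    refine h.card_le_of_dbl hG hq P ?_ ?_
    · intro s hs
      simp only [P, U, Finset.mem_filter, Finset.mem_univ, true_and] at hs
      exact ⟨hs.1, hs.2.1, hs.2.2, hno s q hs.1 hq hs.2.1 hpq.symm hs.2.2 hnqp⟩
    · intro s hs t ht hst
      simp only [P, U, Finset.mem_filter, Finset.mem_univ, true_and] at hs ht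
      exact h.adj_of_not_adj hG hq hs.1 ht.1 hs.2.1 ht.2.1 hs.2.2 ht.2.2 hst
  have hU : U ⊆ P ∪ (U.filter fun t => Dbl G c p (c t)) ∪ (U.filter fun t => Dbl G c q (c t)) := by
    intro t ht
    have htu : Uniq G c v t := by simpa [U] using ht
    simp only [P, Finset.mem_union, Finset.mem_filter, ht, true_and]
    by_cases h1 : t = q
    · exact .inl (.inr (h1 ▸ hno p q hp hq hpq hpq.symm hnpq hnqp))
    by_cases h2 : G.Adj t q
    swap
    · exact .inl (.inl ⟨h1, h2⟩)
    by_cases h3 : G.Adj t p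
    · rcases h.dbl_of_common hG hp hq htu hpq hnpq h3 h2 with h4 | h4
      exacts [.inl (.inr h4), .inr h4]
    · exact .inl (.inr (hno p t hp htu hpq (by rintro rfl; exact hnpq h2) hnpq h3))
  have h1 := (Finset.card_le_card hU).trans ((Finset.card_union_le _ _).trans
    (Nat.add_le_add_right (Finset.card_union_le _ _) _))
  have h2 := h.card_dbl_le_one hG hp
  have h3 := h.card_dbl_le_one hG hq
  have h4 := (h.card_uniq hG).1
  simp only [U] at *
  omega

/-- The uniquely coloured neighbours of `v` form a clique. -/
theorem uniq_clique [Fintype V] (hG : IsObstruction G k) (hk : 8 ≤ k) (h : NearCol G k v c)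
    (hp : Uniq G c v p) (hq : Uniq G c v q) (hpq : p ≠ q) : G.Adj p q := by
  classical
  by_contra hnpq
  have hnqp : ¬ G.Adj q p := fun h' => hnpq h'.symm
  obtain ⟨p₁, q₁, hp₁, hq₁, hpq₁, hqp₁, hnpq₁, hnqp₁, hd₁⟩ :=
    h.exists_not_dbl hG hk hp hq hpq hnpq
  obtain ⟨q₂, p₂, hq₂, hp₂, hqp₂, hpq₂, hnqp₂, hnpq₂, hd₂⟩ :=
    h.exists_not_dbl hG hk hq hp hpq.symm hnqp
  set U := Finset.univ.filter (Uniq G c v) with hUdef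
  have card_rest : ∀ {p q p₁ q₁ : V}, Uniq G c v p → Uniq G c v q → p ≠ q → ¬ G.Adj p q →
      Uniq G c v p₁ → Uniq G c v q₁ → p₁ ≠ q → q₁ ≠ p → ¬ G.Adj p₁ q → ¬ G.Adj q₁ p →
      ¬ Dbl G c p₁ (c q₁) →
      (U.filter fun t => t ≠ p₁ ∧ t ≠ q ∧ ¬ G.Adj t q ∧ ¬ Dbl G c p₁ (c t)).card ≤ 1 := by
    intro p q p₁ q₁ hp hq hpq hnpq hp₁ hq₁ hpq₁ hqp₁ hnpq₁ hnqp₁ hd₁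
    rw [Finset.card_le_one]
    simp only [U, Finset.mem_filter, Finset.mem_univ, true_and]
    rintro s ⟨hs, hs1, hs2, hs3, hs4⟩ t ⟨ht, ht1, ht2, ht3, ht4⟩
    obtain ⟨h1, h2⟩ := h.not_adj_of_not_adj hG hp hq hp₁ hq₁ hpq hnpq hpq₁ hqp₁ hnpq₁ hnqp₁
    exact h.eq_of_not_dbl hG hp₁ hq₁ h1 h2 hd₁ hs ht
      (h.adj_of_not_adj hG hq hp₁ hs hpq₁ hs2 hnpq₁ hs3 hs1.symm)
      (h.adj_of_not_adj hG hq hp₁ ht hpq₁ ht2 hnpq₁ ht3 ht1.symm)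
      (h.not_adj_of_not_adj hG hp hq hs hq₁ hpq hnpq hs2 hqp₁ hs3 hnqp₁).2
      (h.not_adj_of_not_adj hG hp hq ht hq₁ hpq hnpq ht2 hqp₁ ht3 hnqp₁).2 hs4 ht4
  have h1 := card_rest hp hq hpq hnpq hp₁ hq₁ hpq₁ hqp₁ hnpq₁ hnqp₁ hd₁
  have h2 := card_rest hq hp hpq.symm hnqp hq₂ hp₂ hqp₂ hpq₂ hnqp₂ hnpq₂ hd₂
  have h3 := h.card_dbl_le_one hG hp₁
  have h4 := h.card_dbl_le_one hG hq₂
  rw [← hUdef] at h3 h4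
  set A := U.filter fun t => t ≠ p₁ ∧ t ≠ q ∧ ¬ G.Adj t q ∧ ¬ Dbl G c p₁ (c t) with hA
  set B := U.filter fun t => t ≠ q₂ ∧ t ≠ p ∧ ¬ G.Adj t p ∧ ¬ Dbl G c q₂ (c t) with hB
  set D := U.filter fun t => Dbl G c p₁ (c t) with hD
  set E := U.filter fun t => Dbl G c q₂ (c t) with hE
  have hU : U ⊆ A ∪ B ∪ D ∪ E ∪ {p₁, q₂} := by
    intro t ht
    have htu : Uniq G c v t := by simpa [U] using ht
    obtain ⟨h5, h6⟩ := h.not_adj_of_not_adj hG hp hq hp₁ hq₂ hpq hnpq hpq₁ hqp₂ hnpq₁ hnqp₂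
    simp only [hA, hB, hD, hE, Finset.mem_union, Finset.mem_filter, Finset.mem_insert,
      Finset.mem_singleton, ht, true_and]
    by_cases hd₁ : Dbl G c p₁ (c t)
    · exact .inl (.inl (.inr hd₁))
    by_cases hd₂ : Dbl G c q₂ (c t)
    · exact .inl (.inr hd₂)
    by_cases htp₁ : t = p₁
    · exact .inr (.inl htp₁)
    by_cases htq₂ : t = q₂
    · exact .inr (.inr htq₂)
    refine .inl (.inl (.inl ?_))
    by_cases htq : t = q
    · exact .inr ⟨htq₂, htq ▸ hpq.symm, htq ▸ hnqp, hd₂⟩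
    by_cases hatq : G.Adj t q
    swap
    · exact .inl ⟨htp₁, htq, hatq, hd₁⟩
    refine .inr ⟨htq₂, by rintro rfl; exact hnpq hatq, fun hatp => ?_, hd₂⟩
    rcases h.dbl_of_common hG hp₁ hq₂ htu h5 h6
      (h.adj_of_adj_adj hG hp hq htu hp₁ hpq hnpq hatp hatq hpq₁ hnpq₁)
      (h.adj_of_adj_adj hG hq hp htu hq₂ hpq.symm hnqp hatq hatp hqp₂ hnqp₂) with h7 | h7
    exacts [hd₁ h7, hd₂ h7]
  have h5 := Finset.card_le_card hU
  have h6 := Finset.card_union_le (A ∪ B ∪ D ∪ E) {p₁, q₂}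
  have h7 := Finset.card_union_le (A ∪ B ∪ D) E
  have h8 := Finset.card_union_le (A ∪ B) D
  have h9 := Finset.card_union_le A B
  have h10 := Finset.card_le_two (a := p₁) (b := q₂)
  have h11 := (h.card_uniq hG).1
  rw [← hUdef] at h11
  omega

/-- Some colour is repeated around the uncoloured vertex. -/
theorem exists_repeated [Fintype V] (hG : IsObstruction G k) (hk : 8 ≤ k) (h : NearCol G k v c) :
    ∃ s t, s ≠ t ∧ G.Adj v s ∧ G.Adj v t ∧ c s = c t := by
  classical
  by_contra! hno
  have h1 := (h.card_uniq hG).2 fun u hu =>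
    ⟨hu, fun w hw hc => by_contra fun hne => hno w u hne hw hu hc⟩
  have h2 := hG.clique (insert v (Finset.univ.filter (Uniq G c v))) (by
    rw [Finset.coe_insert, SimpleGraph.isClique_insert]
    simp only [Finset.coe_filter, Finset.mem_univ, true_and, Set.mem_ofPred_eq]
    exact ⟨fun p hp q hq hpq => h.uniq_clique hG hk hp hq hpq, fun p hp _ => hp.1⟩)
  rw [Finset.card_insert_of_notMem (by simp [Uniq])] at h2
  omega

theorem exists_uniq_not_adj [Fintype V] (hG : IsObstruction G k) (hk : 8 ≤ k)
    (h : NearCol G k v c) (hvw : G.Adj v w) (hw : ¬ Uniq G c v w) :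
    ∃ m, Uniq G c v m ∧ ¬ G.Adj w m := by
  classical
  by_contra! hno
  have h1 := (h.card_uniq hG).1
  have h2 := hG.clique (insert v (insert w (Finset.univ.filter (Uniq G c v)))) (by
    rw [Finset.coe_insert, Finset.coe_insert, SimpleGraph.isClique_insert,
      SimpleGraph.isClique_insert]
    simp only [Finset.coe_filter, Finset.mem_univ, true_and, Set.mem_ofPred_eq]
    refine ⟨⟨fun p hp q hq hpq => h.uniq_clique hG hk hp hq hpq, fun p hp _ => hno p hp⟩, ?_⟩
    rintro p (rfl | hp) _
    exacts [hvw, hp.1])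
  rw [Finset.card_insert_of_notMem (by simp [Uniq, hvw.ne]),
    Finset.card_insert_of_notMem (by simpa using hw)] at h2
  omega

/-- The neighbourhood of the uncoloured vertex has no four independent vertices. -/
theorem card_independent [Fintype V] (hG : IsObstruction G k) (hk : 8 ≤ k) (h : NearCol G k v c)
    (W : Finset V) (hW : ∀ w ∈ W, G.Adj v w) (hind : ∀ s ∈ W, ∀ t ∈ W, ¬ G.Adj s t) :
    W.card ≤ 3 := by
  classical
  have h1 := (h.card_uniq hG).1
  set U := Finset.univ.filter (Uniq G c v)
  have h2 : (U ∩ W).card ≤ 1 := by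
    rw [Finset.card_le_one]
    simp only [U, Finset.mem_inter, Finset.mem_filter, Finset.mem_univ, true_and]
    rintro s ⟨hs, hsW⟩ t ⟨ht, htW⟩
    by_contra hst
    exact hind s hsW t htW (h.uniq_clique hG hk hs ht hst)
  have h3 := Finset.card_union_add_card_inter U W
  have h4 := hG.deg v (U ∪ W) (by
    intro w hw
    rcases Finset.mem_union.1 hw with hw | hw
    · exact (Finset.mem_filter.1 hw).2.1
    · exact hW w hw)
  omega

/-- Some uniquely coloured neighbour of `v` is adjacent to neither of two neighbours of `v` with a
common colour. -/
theorem exists_uniq_not_adj_pair [Fintype V] (hG : IsObstruction G k) (hk : 8 ≤ k)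
    (h : NearCol G k v c) (hs : G.Adj v s) (ht : G.Adj v t) (hst : s ≠ t) (hc : c s = c t) :
    ∃ m, Uniq G c v m ∧ ¬ G.Adj s m ∧ ¬ G.Adj t m := by
  obtain ⟨m₁, hm₁, hsm₁⟩ := h.exists_uniq_not_adj hG hk hs fun h' => hst (h'.2 t ht hc.symm).symm
  obtain ⟨m₂, hm₂, htm₂⟩ := h.exists_uniq_not_adj hG hk ht fun h' => hst (h'.2 s hs hc)
  by_cases htm₁ : G.Adj t m₁
  swap
  · exact ⟨m₁, hm₁, hsm₁, htm₁⟩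
  by_cases hsm₂ : G.Adj s m₂
  swap
  · exact ⟨m₂, hm₂, hsm₂, htm₂⟩
  have hne : m₂ ≠ m₁ := by rintro rfl; exact hsm₁ hsm₂
  exact (hG.gem s m₂ m₁ t v hsm₂ (h.uniq_clique hG hk hm₂ hm₁ hne) htm₁.symm hsm₁
    (h.not_adj_of_eq hc) (fun h' => htm₂ h'.symm) hs hm₂.1 hm₁.1 ht).elim

/-- Some vertex has four pairwise nonadjacent neighbours. -/
theorem exists_independent [Fintype V] (hG : IsObstruction G k) (hk : 8 ≤ k)
    (h : NearCol G k v c) : ∃ (y : V) (W : Finset V), W.card = 4 ∧ (∀ w ∈ W, G.Adj y w) ∧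
      ∀ s ∈ W, ∀ t ∈ W, ¬ G.Adj s t := by
  classical
  obtain ⟨w₁, w₂, hw, hw₁, hw₂, hc⟩ := h.exists_repeated hG hk
  obtain ⟨m, hm, hwm₁, hwm₂⟩ := h.exists_uniq_not_adj_pair hG hk hw₁ hw₂ hw hc
  have hbk := h.lt hw₁.ne'
  have hbm : c w₁ ≠ c m := fun h' =>
    hw ((hm.2 w₁ hw₁ h').trans (hm.2 w₂ hw₂ (hc ▸ h')).symm)
  have hpair : ∀ s, G.Adj v s → c s = c w₁ → s = w₁ ∨ s = w₂ := by
    intro s hs hsc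
    by_cases hsw : s = w₁
    · exact .inl hsw
    exact (h.excess hG hw₁ hw₂ hw hc hs hw₁ hsw hsc)
  have hmv : ∀ s, G.Adj m s → c s = c w₁ → ¬ G.Adj v s := by
    intro s hms hsc hvs
    rcases hpair s hvs hsc with rfl | rfl
    exacts [hwm₁ hms.symm, hwm₂ hms.symm]
  have hm' := h.shift hm
  obtain ⟨w₃, w₄, hw', hw₃, hw₄, hc₃, hc₄⟩ : Dbl G c m (c w₁) := by
    obtain ⟨w₃, hw₃, hc₃⟩ := hm'.sees hG hbk
    rw [h.shift_eq_iff hm hbk hbm] at hc₃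
    by_contra hd
    have hvw₃ : w₃ ≠ v := h.ne_of_color hw₁.ne' hc₃
    refine hmv w₃ hw₃ hc₃ (hm'.uniq_clique hG hk (h.uniq_shift_self hm)
      (h.uniq_shift hm hvw₃ hw₃ (hc₃ ▸ hd)) hvw₃.symm)
  obtain ⟨q, hvq, hqc, hq⟩ := h.kempe hG hm hbk hbm
  have hmq : ¬ G.Adj m q := fun h' => hmv q h' hqc hvq
  obtain ⟨x, y, hx, hy, hmx, hxy, hyq⟩ := hq.resolve_left hmq
  have hvy : ¬ G.Adj v y := fun h' => hmq (hm.2 y h' hy ▸ hyq)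
  have hm_adj : ∀ s, G.Adj m s → c s = c w₁ → G.Adj y s := by
    intro s hms hsc
    by_contra hys
    exact hG.p5 s m v q y hms.symm hm.1.symm hvq hyq.symm (fun h' => hmv s hms hsc h'.symm)
      (h.not_adj_of_eq (hsc.trans hqc.symm)) (fun h' => hys h'.symm) hmq
      (h.not_adj_of_eq hy.symm) hvy
  have hv_adj : ∀ s, G.Adj v s → c s = c w₁ → G.Adj y s := by
    intro s hvs hsc
    by_contra hys
    exact hG.p5 s v m x y hvs.symm hm.1 hmx hxy (fun h' => hmv s h'.symm hsc hvs)
      (h.not_adj_of_eq (hsc.trans hx.symm)) (fun h' => hys h'.symm) (hmv x hmx hx) hvy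
      (h.not_adj_of_eq hy.symm)
  have hcol : ∀ s ∈ ({w₁, w₂, w₃, w₄} : Finset V), c s = c w₁ := by
    simp [hc, hc₃, hc₄]
  have hne : ∀ s t, G.Adj v s → G.Adj m t → c t = c w₁ → s ≠ t := by
    rintro s t hs ht htc rfl
    exact hmv s ht htc hs
  refine ⟨y, {w₁, w₂, w₃, w₄}, ?_, ?_, fun s hs t ht =>
    h.not_adj_of_eq ((hcol s hs).trans (hcol t ht).symm)⟩
  · simp [hw, hw', hne w₁ w₃ hw₁ hw₃ hc₃, hne w₁ w₄ hw₁ hw₄ hc₄, hne w₂ w₃ hw₂ hw₃ hc₃,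
      hne w₂ w₄ hw₂ hw₄ hc₄]
  · simp only [Finset.mem_insert, Finset.mem_singleton, forall_eq_or_imp, forall_eq]
    exact ⟨hv_adj w₁ hw₁ rfl, hv_adj w₂ hw₂ hc.symm, hm_adj w₃ hw₃ hc₃, hm_adj w₄ hw₄ hc₄⟩

end NearCol

/-- No vertex-minimal obstruction exists. -/
theorem IsObstruction.false [Fintype V] (hG : IsObstruction G k) (hk : 8 ≤ k)
    (hcol : ∀ v, ∃ c, NearCol G k v c) : False := by
  have hV : Nonempty V := by
    by_contra hV
    exact hG.not_col ⟨fun _ => 0, fun x => (hV ⟨x⟩).elim, fun x => (hV ⟨x⟩).elim⟩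
  obtain ⟨c, h⟩ := hcol hV.some
  obtain ⟨y, W, hW, hyW, hind⟩ := h.exists_independent hG hk
  obtain ⟨d, hd⟩ := hcol y
  have := hd.card_independent hG hk W hyW hind
  omega

/-- A `(P₅, gem)`-free graph with maximum degree at most `k + 1` and no clique on `k + 1` vertices
is `k`-colourable if `k ≥ 8`. -/
theorem exists_colouring [Finite V] (hk : 8 ≤ k)
    (p5 : ∀ a b c d e, G.Adj a b → G.Adj b c → G.Adj c d → G.Adj d e → ¬ G.Adj a c → ¬ G.Adj a d →
      ¬ G.Adj a e → ¬ G.Adj b d → ¬ G.Adj b e → ¬ G.Adj c e → False)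
    (gem : ∀ a b c d z, G.Adj a b → G.Adj b c → G.Adj c d → ¬ G.Adj a c → ¬ G.Adj a d →
      ¬ G.Adj b d → G.Adj z a → G.Adj z b → G.Adj z c → G.Adj z d → False)
    (deg : ∀ v (s : Finset V), (∀ w ∈ s, G.Adj v w) → s.card ≤ k + 1)
    (clique : ∀ s : Finset V, G.IsClique s → s.card ≤ k) :
    ∃ c : V → ℕ, (∀ x y, G.Adj x y → c x ≠ c y) ∧ ∀ x, c x < k := by
  classical
  induction hn : Nat.card V using Nat.strong_induction_on generalizing V with
  | _ n ih =>
  have := Fintype.ofFinite V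
  by_contra hno
  refine IsObstruction.false (G := G) ⟨p5, gem, deg, clique, hno⟩ hk fun v => ?_
  obtain ⟨c, hc, hck⟩ := ih (Nat.card {w // w ≠ v})
    (by
      rw [← hn, Nat.card_eq_fintype_card, Nat.card_eq_fintype_card]
      exact Fintype.card_subtype_lt (x := v) (not_not.2 rfl))
    (G := G.comap Subtype.val) (fun a b c d e => p5 a.1 b.1 c.1 d.1 e.1)
    (fun a b c d z => gem a.1 b.1 c.1 d.1 z.1)
    (fun w s hs => by
      rw [← Finset.card_map (Function.Embedding.subtype _)]
      refine deg w _ ?_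
      simp only [Finset.mem_map, Function.Embedding.subtype_apply]
      rintro _ ⟨x, hx, rfl⟩
      exact hs x hx)
    (fun s hs => by
      rw [← Finset.card_map (Function.Embedding.subtype _)]
      refine clique _ ?_
      rw [Finset.coe_map]
      rintro _ ⟨x, hx, rfl⟩ _ ⟨y, hy, rfl⟩ hxy
      exact hs hx hy fun h => hxy (h ▸ rfl)) rfl
  refine ⟨fun w => if h : w ≠ v then c ⟨w, h⟩ else k, ?_, by simp, ?_⟩
  · intro x y hxy
    by_cases hx : x = v <;> by_cases hy : y = v
    · subst hx hy; simp at hxy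
    · simpa [hx, hy] using (hck _).ne'
    · simpa [hx, hy] using (hck _).ne
    · simpa [hx, hy] using hc ⟨x, hx⟩ ⟨y, hy⟩ hxy
  · intro x hx
    simpa [hx] using hck ⟨x, hx⟩

end NearColouring

/-- A map into `G` that preserves and reflects adjacency realizes a graph in which distinct vertices
have distinct neighbourhoods as an induced subgraph of `G`. -/
theorem exists_iso_induce {V W : Type*} {G : SimpleGraph V} {H : SimpleGraph W} (f : W → V)
    (hH : ∀ i j, (∀ l, H.Adj i l ↔ H.Adj j l) → i = j)
    (h : ∀ i j, G.Adj (f i) (f j) ↔ H.Adj i j) : ∃ s : Set V, Nonempty (H ≃g G.induce s) :=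
  have hf : Function.Injective f := fun i j hij => hH i j fun l => by rw [← h, ← h, hij]
  ⟨Set.range f, ⟨⟨Equiv.ofInjective f hf, fun {i j} => by simpa using h i j⟩⟩⟩

theorem pathGraph_five_eq_of_adj_iff (i j : Fin 5)
    (h : ∀ l, (pathGraph 5).Adj i l ↔ (pathGraph 5).Adj j l) : i = j := by
  simp only [pathGraph_adj] at h
  revert i j
  decide

theorem gem_eq_of_adj_iff (i j : Fin 5) (h : ∀ l, gem.Adj i l ↔ gem.Adj j l) : i = j := by
  simp only [gem, fromEdgeSet_adj, Set.mem_insert_iff, Set.mem_singleton_iff] at h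
  revert i j
  decide

/-- The Borodin–Kostochka Conjecture for (P₅, gem)-free graphs. -/
theorem stmt18 {V : Type*} [Fintype V] (G : SimpleGraph V)
    (hP5 : ∀ s : Set V, ¬ Nonempty (pathGraph 5 ≃g G.induce s))
    (hgem : ∀ s : Set V, ¬ Nonempty (gem ≃g G.induce s))
    (hΔ : 9 ≤ maxDeg G) (hω : G.cliqueNum ≤ maxDeg G - 1) :
    G.chromaticNumber ≤ ((maxDeg G - 1 : ℕ) : ℕ∞) := by
  have deg : ∀ v (s : Finset V), (∀ w ∈ s, G.Adj v w) → s.card ≤ maxDeg G := by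
    intro v s hs
    calc s.card = (s : Set V).ncard := (Set.ncard_coe_finset s).symm
      _ ≤ (G.neighborSet v).ncard := Set.ncard_le_ncard hs (Set.toFinite _)
      _ ≤ maxDeg G := Finset.le_sup (f := fun v => (G.neighborSet v).ncard) (Finset.mem_univ v)
  obtain ⟨c, hc, hck⟩ := exists_colouring (G := G) (k := maxDeg G - 1) (by omega)
    (fun a b c d e hab hbc hcd hde hac had hae hbd hbe hce => by
      obtain ⟨s, hs⟩ := exists_iso_induce (G := G) ![a, b, c, d, e]
        pathGraph_five_eq_of_adj_iff fun i j => by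
          fin_cases i <;> fin_cases j <;> simp [pathGraph_adj, hab, hbc, hcd, hde, hac, had, hae,
            hbd, hbe, hce, G.adj_comm b a, G.adj_comm c a, G.adj_comm d a,
            G.adj_comm e a, G.adj_comm c b, G.adj_comm d b, G.adj_comm e b, G.adj_comm d c,
            G.adj_comm e c, G.adj_comm e d]
      exact hP5 s hs)
    (fun a b c d z hab hbc hcd hac had hbd hza hzb hzc hzd => by
      obtain ⟨s, hs⟩ := exists_iso_induce (G := G) ![a, b, c, d, z]
        gem_eq_of_adj_iff fun i j => by
          fin_cases i <;> fin_cases j <;> simp [gem, hab, hbc, hcd, hac, had, hbd, hza.symm,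
            hzb.symm, hzc.symm, hzd.symm, G.adj_comm b a, G.adj_comm c a, G.adj_comm d a,
            G.adj_comm z a, G.adj_comm c b, G.adj_comm d b, G.adj_comm z b, G.adj_comm d c,
            G.adj_comm z c, G.adj_comm z d]
      exact hgem s hs)
    (fun v s hs => (deg v s hs).trans (by omega))
    (fun s hs => hs.card_le_cliqueNum.trans hω)
  exact Colorable.chromaticNumber_le
    ⟨Coloring.mk (fun v => ⟨c v, hck v⟩) fun {x y} hxy h => hc x y hxy (congrArg Fin.val h)⟩
end
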